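/- Let f : X → Y be a finite surjective morphism of schemes. If X is an affine scheme, then Y is an affine scheme. -/

import Mathlib

open AlgebraicGeometry

theorem exists_isNilpotent_add_eq {R S T : Type*} [CommRing R] [CommRing S] [CommRing T]
    (α : R →+* T) (β : S →+* T) (f : R) (g : S) {n : ℕ} (hn : (α f - β g) ^ n = 0)
    (hα : ∀ ν : T, IsNilpotent ν → ∃ (k : ℕ) (ρ : R), IsNilpotent ρ ∧ α ρ = ν * α (1 - f) ^ k)
    (hβ : ∀ ν : T, IsNilpotent ν → ∃ (k : ℕ) (σ : S), IsNilpotent σ ∧ β σ = ν * β g ^ k)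
    (ν : T) (hν : IsNilpotent ν) :
    ∃ (ρ : R) (σ : S), IsNilpotent ρ ∧ IsNilpotent σ ∧ ν = α ρ + β σ := by
  suffices H : ∀ m, ∀ ν : T, IsNilpotent ν → ν * (α f - β g) ^ m = 0 →
      ∃ (ρ : R) (σ : S), IsNilpotent ρ ∧ IsNilpotent σ ∧ ν = α ρ + β σ from
    H n ν hν (by rw [hn, mul_zero])
  clear hν ν
  intro m
  induction m with
  | zero =>
    intro ν _ h
    exact ⟨0, 0, .zero, .zero, by simpa using h⟩
  | succ m ih =>
    intro ν hν h
    obtain ⟨k, ρ, hρ, hρ'⟩ := hα ν hν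
    obtain ⟨l, σ, hσ, hσ'⟩ := hβ ν hν
    obtain ⟨P, Q, hPQ⟩ : IsCoprime ((1 - Polynomial.X : Polynomial ℤ) ^ k) (Polynomial.X ^ l) :=
      IsCoprime.pow ⟨1, 1, by ring⟩
    obtain ⟨c, hc⟩ := (Q * Polynomial.X ^ l).map (Int.castRingHom T) |>.sub_dvd_eval_sub (α f) (β g)
    have h1 := congr(Polynomial.aeval (α f) $hPQ)
    have hPα : Polynomial.aeval (α f) P = α (Polynomial.aeval f P) :=
      Polynomial.aeval_algHom_apply α.toIntAlgHom f P
    have hQβ : Polynomial.aeval (β g) Q = β (Polynomial.aeval g Q) :=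
      Polynomial.aeval_algHom_apply β.toIntAlgHom g Q
    have e (x : T) (p : Polynomial ℤ) :
        (p.map (Int.castRingHom T)).eval x = Polynomial.aeval x p := by
      rw [Polynomial.eval_map, Polynomial.aeval_def]; rfl
    rw [e, e] at hc
    simp only [map_mul, map_add, map_pow, map_sub, map_one, Polynomial.aeval_X, hPα, hQβ] at h1 hc
    obtain ⟨ρ', σ', h₁, h₂, h₃⟩ := ih (ν * (α f - β g) * c)
      (by rw [mul_assoc]; exact (Commute.all _ _).isNilpotent_mul_right hν)
      (by linear_combination c * h)
    refine ⟨ρ * Polynomial.aeval f P + ρ', σ * Polynomial.aeval g Q + σ',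
      (Commute.all _ _).isNilpotent_add ((Commute.all _ _).isNilpotent_mul_right hρ) h₁,
      (Commute.all _ _).isNilpotent_add ((Commute.all _ _).isNilpotent_mul_right hσ) h₂, ?_⟩
    simp only [map_mul, map_add, hρ', hσ', map_sub, map_one]
    linear_combination -ν * h1 + ν * hc + h₃

theorem exists_isNilpotent_eq_mul_pow {R T : Type*} [CommRing R] [CommRing T] [Algebra R T]
    (g : R) [IsLocalization.Away g T] (ν : T) (hν : IsNilpotent ν) :
    ∃ (k : ℕ) (ρ : R), IsNilpotent ρ ∧ algebraMap R T ρ = ν * algebraMap R T g ^ k := by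
  obtain ⟨k, r, hr⟩ := IsLocalization.Away.surj g ν
  obtain ⟨n, hn⟩ : IsNilpotent (algebraMap R T r) :=
    hr ▸ (Commute.all _ _).isNilpotent_mul_right hν
  rw [← map_pow, IsLocalization.map_eq_zero_iff (Submonoid.powers g)] at hn
  obtain ⟨⟨_, m, rfl⟩, hm⟩ := hn
  refine ⟨k + 1, g * r, ⟨m + n, ?_⟩, ?_⟩
  · linear_combination g ^ n * r ^ m * hm
  · rw [map_mul, ← hr]; ring

section Charpoly

open Polynomial nonZeroDivisors

variable (R S K L : Type*) [CommRing R] [IsDomain R] [CommRing S] [IsDomain S] [Field K]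
  [Field L] [Algebra R S] [Module.Finite R S] [FaithfulSMul R S] [Algebra R K] [IsFractionRing R K]
  [Algebra S L] [IsFractionRing S L] [Algebra K L] [Algebra R L] [IsScalarTower R S L]
  [IsScalarTower R K L]

theorem Module.Finite.of_isFractionRing (R S K L : Type*) [CommRing R] [IsDomain R] [CommRing S]
    [IsDomain S] [Field K] [Field L] [Algebra R S] [Module.Finite R S] [FaithfulSMul R S]
    [Algebra R K] [IsFractionRing R K] [Algebra S L] [IsFractionRing S L] [Algebra K L]
    [Algebra R L] [IsScalarTower R S L] [IsScalarTower R K L] : Module.Finite K L := by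
  obtain ⟨T, hT⟩ := Module.Finite.fg_top (R := R) (M := S)
  have hspan := span_eq_top_of_isLocalizedModule K R⁰ (IsScalarTower.toAlgHom R S L).toLinearMap hT
  exact Module.finite_def.mpr (hspan ▸ Submodule.fg_span (T.finite_toSet.image _))

theorem exists_basis_smul_repr_mem_range [Module.Finite K L] :
    ∃ (e : Module.Basis (Fin (Module.finrank K L)) K L)
      (h : R), h ≠ 0 ∧ (∀ i, e i ∈ Set.range (algebraMap S L)) ∧
      ∀ s i, e.repr (algebraMap S L (h • s)) i ∈ Set.range (algebraMap R K) := by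
  obtain ⟨T, hT⟩ := Module.Finite.fg_top (R := R) (M := S)
  have hspan := span_eq_top_of_isLocalizedModule K R⁰ (IsScalarTower.toAlgHom R S L).toLinearMap hT
  let e' := Module.Basis.ofSpan hspan.ge
  have := Module.Finite.finite_basis e'
  have := Fintype.ofFinite
    ((linearIndepOn_empty K id).extend (Set.empty_subset
      (⇑(IsScalarTower.toAlgHom R S L).toLinearMap '' (T : Set S))))
  let e := e'.reindex (Fintype.equivFinOfCardEq (Module.finrank_eq_card_basis e').symm)
  have he (i) : e i ∈ (IsScalarTower.toAlgHom R S L).toLinearMap '' (T : Set S) := by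
    rw [Module.Basis.reindex_apply]
    exact Module.Basis.ofSpan_subset hspan.ge ⟨_, rfl⟩
  obtain ⟨h, hh⟩ := IsLocalization.exist_integer_multiples_of_finite R⁰
    (fun x : T × _ ↦ e.repr (algebraMap S L x.1) x.2)
  refine ⟨e, h, nonZeroDivisors.ne_zero h.2, fun i ↦ ?_, fun s i ↦ ?_⟩
  · obtain ⟨s, -, hs⟩ := he i
    exact ⟨s, hs⟩
  · have hs : s ∈ Submodule.span R (T : Set S) := hT ▸ Submodule.mem_top
    induction hs using Submodule.span_induction with
    | mem x hx =>
      obtain ⟨r, hr⟩ := hh (⟨x, hx⟩, i)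
      refine ⟨r, hr.trans ?_⟩
      rw [Algebra.smul_def h.1 x, map_mul, ← IsScalarTower.algebraMap_apply R S L,
        IsScalarTower.algebraMap_apply R K L, ← Algebra.smul_def (A := L), map_smul e.repr,
        Finsupp.smul_apply,
        Algebra.smul_def, smul_eq_mul]
    | zero => exact ⟨0, by simp⟩
    | add x y _ _ hx hy =>
      obtain ⟨a, ha⟩ := hx
      obtain ⟨b, hb⟩ := hy
      exact ⟨a + b, by simp only [smul_add, map_add, Finsupp.add_apply, ha, hb]⟩
    | smul r x _ hx =>
      obtain ⟨a, ha⟩ := hx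
      refine ⟨r * a, ?_⟩
      rw [smul_comm, Algebra.smul_def r, map_mul, map_mul (algebraMap S L),
        ← IsScalarTower.algebraMap_apply R S L, IsScalarTower.algebraMap_apply R K L,
        ← Algebra.smul_def (A := L),
        map_smul e.repr, Finsupp.smul_apply, ← ha, smul_eq_mul]

/-- Let `S` be a finite extension of a domain `R`, with fraction fields `L` and `K`. There is a
nonzero `h : R` such that for `b : S` congruent to `t : R` modulo a suitable multiple of `h`, the
characteristic polynomial of `b` has coefficients in `R`, and its constant term is controlled. -/
theorem exists_charpoly_eq_map [Module.Finite K L] :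
    ∃ h : R, h ≠ 0 ∧ ∀ (I : Ideal R) (t : R) (b : S),
    b - algebraMap R S t ∈ (Ideal.span {h} * I).map (algebraMap R S) →
    ∃ p : R[X], p.map (algebraMap R K) =
      (Algebra.lmul K L (algebraMap S L b)).charpoly ∧
      p.coeff 0 - (-t) ^ (Module.finrank K L) ∈ I := by
  classical
  obtain ⟨e, h, h0, he, hr⟩ := exists_basis_smul_repr_mem_range R S K L
  refine ⟨h, h0, fun I t b hb ↦ ?_⟩
  have key (w : S) (hw : w ∈ (Ideal.span {h} * I).map (algebraMap R S)) (s : S) (i) :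
      e.repr (algebraMap S L (w * s)) i ∈ (algebraMap R K) '' I := by
    rw [Ideal.map, ← Ideal.submodule_span_eq] at hw
    induction hw using Submodule.span_induction generalizing s with
    | mem x hx =>
      obtain ⟨_, hx, rfl⟩ := hx
      obtain ⟨z, hz, rfl⟩ := Ideal.mem_span_singleton_mul.mp hx
      obtain ⟨a, ha⟩ := hr s i
      refine ⟨z * a, I.mul_mem_right _ hz, ?_⟩
      rw [show algebraMap R S (h * z) * s = algebraMap R S z * (h • s) by
          rw [Algebra.smul_def, map_mul]; ring, map_mul, map_mul (algebraMap S L),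
        ← IsScalarTower.algebraMap_apply R S L,
        IsScalarTower.algebraMap_apply R K L, ← Algebra.smul_def (A := L), map_smul e.repr,
        Finsupp.smul_apply,
        ha, smul_eq_mul]
    | zero => exact ⟨0, I.zero_mem, by simp⟩
    | add x y _ _ hx hy =>
      obtain ⟨a, ha, ha'⟩ := hx s
      obtain ⟨b, hb, hb'⟩ := hy s
      exact ⟨a + b, add_mem ha hb, by simp only [map_add, Finsupp.add_apply, ha', hb', add_mul]⟩
    | smul r x _ ih =>
      rw [smul_eq_mul, mul_comm r, mul_assoc]
      exact ih _
  have key' (i j) : e.repr (algebraMap S L (b - algebraMap R S t) * e j) i ∈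
      (algebraMap R K) '' I := by
    obtain ⟨s, hs⟩ := he j
    rw [← hs, ← map_mul]
    exact key _ hb s i
  choose N hNI hN using key'
  let M : Matrix _ _ R := Matrix.scalar _ t + Matrix.of N
  have hM : M.map (algebraMap R K) =
      LinearMap.toMatrix e e (Algebra.lmul K L (algebraMap S L b)) := by
    ext i j
    rw [LinearMap.toMatrix_apply, Algebra.coe_lmul_eq_mul, LinearMap.mul_apply',
      ← sub_add_cancel b (algebraMap R S t), map_add, add_mul, map_add, Finsupp.add_apply, ← hN,
      ← IsScalarTower.algebraMap_apply R S L, IsScalarTower.algebraMap_apply R K L,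
      ← Algebra.smul_def (A := L), map_smul e.repr, Finsupp.smul_apply, Module.Basis.repr_self]
    obtain rfl | hij := eq_or_ne i j
    · simp [M, add_comm]
    · simp [M, hij]
  refine ⟨M.charpoly, ?_, ?_⟩
  · rw [← Matrix.charpoly_map, hM, LinearMap.charpoly_toMatrix]
  · rw [← Ideal.Quotient.eq_zero_iff_mem, map_sub, sub_eq_zero, ← Polynomial.coeff_map,
      ← Matrix.charpoly_map]
    have : M.map (Ideal.Quotient.mk I) = Matrix.diagonal fun _ ↦ Ideal.Quotient.mk I t := by
      ext i j
      have := Ideal.Quotient.eq_zero_iff_mem.mpr (hNI i j)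
      obtain rfl | hij := eq_or_ne i j
      · simp [M, this]
      · simp [M, this, hij]
    rw [this, Matrix.charpoly_diagonal]
    simp [Polynomial.coeff_zero_eq_eval_zero]

end Charpoly

section RingHom

variable {R S : Type*} (K L : Type*) [CommRing R] [IsDomain R] [CommRing S] [IsDomain S] [Field K]
  [Field L] [Algebra R K] [IsFractionRing R K] [Algebra S L] [IsFractionRing S L] [Algebra K L]
  {α : R →+* S}

theorem RingHom.Finite.finite_of_isFractionRing (hα : α.Finite) (hα' : Function.Injective α)
    (h : ∀ r, algebraMap K L (algebraMap R K r) = algebraMap S L (α r)) : Module.Finite K L := by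
  let := α.toAlgebra
  let := ((algebraMap S L).comp α).toAlgebra
  have : IsScalarTower R S L := .of_algebraMap_eq fun _ ↦ rfl
  have : IsScalarTower R K L := .of_algebraMap_eq fun r ↦ (h r).symm
  have : Module.Finite R S := hα
  have : FaithfulSMul R S := (faithfulSMul_iff_algebraMap_injective R S).mpr hα'
  exact Module.Finite.of_isFractionRing R S K L

theorem RingHom.Finite.exists_charpoly_eq_map [Module.Finite K L] (hα : α.Finite)
    (hα' : Function.Injective α)
    (h : ∀ r, algebraMap K L (algebraMap R K r) = algebraMap S L (α r)) :
    ∃ h : R, h ≠ 0 ∧ ∀ (I : Ideal R) (t : R) (b : S), b - α t ∈ (Ideal.span {h} * I).map α →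
      ∃ p : Polynomial R, p.map (algebraMap R K) =
        (Algebra.lmul K L (algebraMap S L b)).charpoly ∧
        p.coeff 0 - (-t) ^ (Module.finrank K L) ∈ I := by
  let := α.toAlgebra
  let := ((algebraMap S L).comp α).toAlgebra
  have : IsScalarTower R S L := .of_algebraMap_eq fun _ ↦ rfl
  have : IsScalarTower R K L := .of_algebraMap_eq fun r ↦ (h r).symm
  have : Module.Finite R S := hα
  have : FaithfulSMul R S := (faithfulSMul_iff_algebraMap_injective R S).mpr hα'
  exact _root_.exists_charpoly_eq_map R S K L

end RingHom

theorem RingHom.isIntegral_of_forall_isIntegralElem {A B B' C : Type*} [CommRing A] [CommRing B]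
    [CommRing B'] [CommRing C] {φ : A →+* B} {π : B →+* B'} {g : C →+* B'} (hg : g.IsIntegral)
    (hπ : Function.Surjective π) (h : ∀ b c, π b = g c → φ.IsIntegralElem b) : φ.IsIntegral := by
  let _ : Algebra A B := φ.toAlgebra
  intro b
  cases subsingleton_or_nontrivial B'
  · exact h b 0 (Subsingleton.elim _ _)
  obtain ⟨P, hP, hPb, hPd⟩ : ∃ P : Polynomial C, P.Monic ∧ P.eval₂ g (π b) = 0 ∧
      (P.map g).natDegree ≠ 0 := by
    obtain ⟨P, hP, hPb⟩ := hg (π b)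
    refine ⟨P * Polynomial.X, hP.mul Polynomial.monic_X, by simp [hPb], ?_⟩
    rw [Polynomial.map_mul, Polynomial.map_X, (hP.map g).natDegree_mul Polynomial.monic_X,
      Polynomial.natDegree_X]
    exact Nat.succ_ne_zero _
  let ψ : integralClosure A B →+* B' := π.comp (integralClosure A B).val.toRingHom
  have hl : P.map g ∈ Polynomial.lifts ψ := by
    rw [Polynomial.lifts_iff_coeff_lifts]
    intro i
    obtain ⟨c, hc⟩ := hπ (g (P.coeff i))
    exact ⟨⟨c, h c _ hc⟩, by rw [Polynomial.coeff_map]; exact hc⟩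
  obtain ⟨Q, hQ, hQd, hQm⟩ := Polynomial.lifts_and_natDegree_eq_and_monic hl (hP.map g)
  have hc : _root_.IsIntegral A (Polynomial.aeval b Q) := by
    refine h _ 0 ?_
    have h1 := Polynomial.hom_eval₂ Q (algebraMap (integralClosure A B) B) π b
    rw [Polynomial.aeval_def, h1, map_zero, ← hPb, ← Polynomial.eval_map g, ← hQ,
      Polynomial.eval_map]
    rfl
  have hb : _root_.IsIntegral (integralClosure A B) b :=
    _root_.IsIntegral.of_aeval_monic hQm (hQd ▸ hPd) hc.tower_top
  exact isIntegral_trans (R := A) b hb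

namespace AlgebraicGeometry

open CategoryTheory TopologicalSpace Opposite Limits

universe u

variable {X Y : Scheme.{u}}

namespace Scheme

theorem basicOpen_add_isNilpotent {Y : Scheme} {U : Y.Opens} (f ρ : Γ(Y, U))
    (hρ : IsNilpotent ρ) : Y.basicOpen (f + ρ) = Y.basicOpen f := by
  have key (f ρ : Γ(Y, U)) (hρ : IsNilpotent ρ) : Y.basicOpen f ≤ Y.basicOpen (f + ρ) := by
    intro x hx
    have hxU := Y.basicOpen_le f hx
    rw [Y.mem_basicOpen _ x hxU] at hx ⊢
    rw [map_add]
    exact (hρ.map _).isUnit_add_left_of_commute hx (Commute.all _ _)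
  refine le_antisymm ?_ (key f ρ hρ)
  simpa using key (f + ρ) (-ρ) hρ.neg

theorem exists_res_eq {Y : Scheme} {W U₁ U₂ : Y.Opens} (h₁ : U₁ ≤ W) (h₂ : U₂ ≤ W)
    (hW : W ≤ U₁ ⊔ U₂) (a : Γ(Y, U₁)) (b : Γ(Y, U₂))
    (h : Y.presheaf.map (homOfLE (inf_le_left : U₁ ⊓ U₂ ≤ U₁)).op a =
      Y.presheaf.map (homOfLE (inf_le_right : U₁ ⊓ U₂ ≤ U₂)).op b) :
    ∃ s : Γ(Y, W), Y.presheaf.map (homOfLE h₁).op s = a ∧ Y.presheaf.map (homOfLE h₂).op s = b := by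
  obtain ⟨s, hs, -⟩ := Y.sheaf.existsUnique_gluing' (ι := Bool) (fun i ↦ cond i U₁ U₂) W
    (fun i ↦ homOfLE (by cases i <;> assumption)) (hW.trans (sup_le (le_iSup_of_le true le_rfl)
      (le_iSup_of_le false le_rfl))) (fun i ↦ match i with | true => a | false => b) (by
      rintro (_ | _) (_ | _)
      · rfl
      · have := congr(Y.presheaf.map (homOfLE (inf_comm U₂ U₁).le).op $h)
        simp only [← ConcreteCategory.comp_apply, ← Functor.map_comp] at this
        exact this.symm
      · exact h
      · rfl)
  exact ⟨s, hs true, hs false⟩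

theorem isAffineOpen_of_isNilpotent_sub {Y : Scheme} {W U₁ U₂ : Y.Opens} (h₁ : IsAffineOpen U₁)
    (h₂ : IsAffineOpen U₂) (hl : U₁ ≤ W) (hr : U₂ ≤ W) (hW : W ≤ U₁ ⊔ U₂)
    (f : Γ(Y, U₁)) (g : Γ(Y, U₂))
    (hf : Y.basicOpen f = U₁) (hf' : Y.basicOpen (1 - f) = U₁ ⊓ U₂)
    (hg : Y.basicOpen g = U₁ ⊓ U₂) (hg' : Y.basicOpen (1 - g) = U₂)
    (h : IsNilpotent (Y.presheaf.map (homOfLE (inf_le_left : U₁ ⊓ U₂ ≤ U₁)).op f -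
      Y.presheaf.map (homOfLE (inf_le_right : U₁ ⊓ U₂ ≤ U₂)).op g)) :
    IsAffineOpen W := by
  let α := (Y.presheaf.map (homOfLE (inf_le_left : U₁ ⊓ U₂ ≤ U₁)).op).hom
  let β := (Y.presheaf.map (homOfLE (inf_le_right : U₁ ⊓ U₂ ≤ U₂)).op).hom
  have hα := h₁.isLocalization_of_eq_basicOpen (1 - f) (homOfLE inf_le_left) hf'.symm
  have hβ := h₂.isLocalization_of_eq_basicOpen g (homOfLE inf_le_right) hg.symm
  have h' : IsNilpotent (α f - β g) := h
  obtain ⟨n, hn⟩ := h'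
  obtain ⟨ρ, σ, hρ, hσ, e⟩ := exists_isNilpotent_add_eq α β f g hn
    (fun ν hν ↦ letI := α.toAlgebra; exists_isNilpotent_eq_mul_pow (1 - f) ν hν)
    (fun ν hν ↦ letI := β.toAlgebra; exists_isNilpotent_eq_mul_pow g ν hν) _ ⟨n, hn⟩
  obtain ⟨s, hs₁, hs₂⟩ := exists_res_eq hl hr hW (f - ρ) (g + σ) (by
    change α (f - ρ) = β (g + σ)
    rw [map_sub, map_add]
    linear_combination e)
  have hsf : Y.basicOpen s = U₁ := by
    have e₁ : U₁ ⊓ Y.basicOpen s = U₁ := by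
      rw [← Y.basicOpen_res _ (homOfLE hl).op, hs₁, sub_eq_add_neg,
        basicOpen_add_isNilpotent _ _ hρ.neg, hf]
    have e₂ : U₂ ⊓ Y.basicOpen s = U₁ ⊓ U₂ := by
      rw [← Y.basicOpen_res _ (homOfLE hr).op, hs₂, basicOpen_add_isNilpotent _ _ hσ, hg]
    refine le_antisymm ?_ (inf_eq_left.mp e₁)
    rw [← inf_eq_right.mpr ((Y.basicOpen_le s).trans hW), inf_sup_right, e₁, e₂]
    exact sup_le le_rfl inf_le_left
  have hsg : Y.basicOpen (1 - s) = U₂ := by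
    have e₁ : U₁ ⊓ Y.basicOpen (1 - s) = U₁ ⊓ U₂ := by
      rw [← Y.basicOpen_res _ (homOfLE hl).op, map_sub, map_one, hs₁, sub_sub_eq_add_sub,
        add_sub_right_comm, basicOpen_add_isNilpotent _ _ hρ, hf']
    have e₂ : U₂ ⊓ Y.basicOpen (1 - s) = U₂ := by
      rw [← Y.basicOpen_res _ (homOfLE hr).op, map_sub, map_one, hs₂, ← sub_sub, sub_eq_add_neg,
        basicOpen_add_isNilpotent _ _ hσ.neg, hg']
    refine le_antisymm ?_ (inf_eq_left.mp e₂)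
    rw [← inf_eq_right.mpr ((Y.basicOpen_le (1 - s)).trans hW), inf_sup_right, e₁, e₂]
    exact sup_le inf_le_right le_rfl
  refine isAffineOpen_of_isAffineOpen_basicOpen W {s, 1 - s} ?_ ?_
  · rw [Ideal.eq_top_iff_one, ← add_sub_cancel s 1]
    exact add_mem (Ideal.subset_span (by simp)) (Ideal.subset_span (by simp))
  · rintro _ (rfl | rfl)
    · rwa [hsf]
    · rwa [hsg]

end Scheme

theorem IsAffineOpen.isAffine_of_top {Y : Scheme} (h : IsAffineOpen (⊤ : Y.Opens)) : IsAffine Y :=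
  isAffine_of_isAffineOpen_basicOpen {1} (by simp) (by simpa using h)

theorem Scheme.Hom.preimage_le_preimage_iff {Z Y : Scheme} (i : Z ⟶ Y) [Surjective i]
    {U V : Y.Opens} : i ⁻¹ᵁ U ≤ i ⁻¹ᵁ V ↔ U ≤ V :=
  i.surjective.preimage_subset_preimage_iff

theorem Scheme.Hom.preimage_injective_of_surjective {Z Y : Scheme} (i : Z ⟶ Y) [Surjective i] :
    Function.Injective (i ⁻¹ᵁ ·) := fun U V (h : i ⁻¹ᵁ U = i ⁻¹ᵁ V) ↦
  le_antisymm (i.preimage_le_preimage_iff.mp h.le) (i.preimage_le_preimage_iff.mp h.ge)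

theorem Scheme.isUnit_res_of_le_basicOpen {X : Scheme} {U V : X.Opens} (f : Γ(X, U))
    (h : V ≤ X.basicOpen f) :
    IsUnit (X.presheaf.map (homOfLE (h.trans (X.basicOpen_le f))).op f) := by
  convert! (X.toRingedSpace.isUnit_res_basicOpen f).map (X.presheaf.map (homOfLE h).op).hom
  exact ConcreteCategory.congr_hom (X.presheaf.map_comp (homOfLE (X.basicOpen_le f)).op
    (homOfLE h).op) f

namespace IsClosedImmersion

variable {Z Y : Scheme} (i : Z ⟶ Y) [IsClosedImmersion i]

theorem exists_app_eq_res {U : Y.Opens} {V : Z.Opens} (hU : IsAffineOpen U) (h : i ⁻¹ᵁ U ≤ V)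
    (t : Γ(Z, V)) : ∃ f : Γ(Y, U), i.app U f = Z.presheaf.map (homOfLE h).op t :=
  i.app_surjective U hU _

theorem isAffineOpen_of_preimage_eq_basicOpen [Surjective i] {W U₁ U₂ : Y.Opens}
    (h₁ : IsAffineOpen U₁) (h₂ : IsAffineOpen U₂) (hl : U₁ ≤ W) (hr : U₂ ≤ W)
    (t : Γ(Z, i ⁻¹ᵁ W)) (ht : i ⁻¹ᵁ U₁ = Z.basicOpen t) (ht' : i ⁻¹ᵁ U₂ = Z.basicOpen (1 - t)) :
    IsAffineOpen W := by
  obtain ⟨f, hf⟩ := exists_app_eq_res i h₁ (i.preimage_mono hl) t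
  obtain ⟨g, hg⟩ := exists_app_eq_res i h₂ (i.preimage_mono hr) t
  have hgb : Y.basicOpen g = U₁ ⊓ U₂ := by
    apply i.preimage_injective_of_surjective
    simp only [Scheme.preimage_basicOpen, hg, Scheme.basicOpen_res, Scheme.Hom.preimage_inf, ht]
    exact inf_comm _ _
  refine Scheme.isAffineOpen_of_isNilpotent_sub h₁ h₂ hl hr ?_ f g ?_ ?_ hgb ?_ ?_
  · rw [← i.preimage_le_preimage_iff, Scheme.Hom.preimage_sup, ht, ht']
    refine le_trans ?_ (Z.basicOpen_add_le t (1 - t))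
    rw [add_sub_cancel, Scheme.basicOpen_one]
  · apply i.preimage_injective_of_surjective
    simp only [Scheme.preimage_basicOpen, hf, Scheme.basicOpen_res, ht, inf_idem]
  · apply i.preimage_injective_of_surjective
    simp only [Scheme.preimage_basicOpen, map_sub, map_one, hf, Scheme.Hom.preimage_inf, ht']
    rw [← map_one (Z.presheaf.map (homOfLE (i.preimage_mono hl)).op).hom, ← map_sub,
      Scheme.basicOpen_res]
  · apply i.preimage_injective_of_surjective
    simp only [Scheme.preimage_basicOpen, map_sub, map_one, hg]
    rw [← map_one (Z.presheaf.map (homOfLE (i.preimage_mono hr)).op).hom, ← map_sub,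
      Scheme.basicOpen_res, ht', inf_idem]
  · rw [Scheme.isNilpotent_iff_basicOpen_eq_bot_of_isCompact
      (by rw [← hgb]; exact (h₂.basicOpen g).isCompact)]
    apply i.preimage_injective_of_surjective
    simp only [Scheme.preimage_basicOpen, map_sub]
    convert! Scheme.basicOpen_zero Z _ using 2
    rw [sub_eq_zero]
    have e₁ := congr(Z.presheaf.map (homOfLE (i.preimage_mono (inf_le_left : U₁ ⊓ U₂ ≤ _))).op $hf)
    have e₂ := congr(Z.presheaf.map (homOfLE (i.preimage_mono (inf_le_right : U₁ ⊓ U₂ ≤ _))).op $hg)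
    simp only [← ConcreteCategory.comp_apply, ← Functor.map_comp] at e₁ e₂
    have n₁ := i.naturality (homOfLE (inf_le_left : U₁ ⊓ U₂ ≤ U₁)).op
    have n₂ := i.naturality (homOfLE (inf_le_right : U₁ ⊓ U₂ ≤ U₂)).op
    have := congr($n₁ f)
    have := congr($n₂ g)
    simp only [ConcreteCategory.comp_apply] at *
    exact (congr($n₁ f).trans e₁).trans (congr($n₂ g).trans e₂).symm

/-- A scheme is affine if it receives a surjective closed immersion from an affine scheme. -/
theorem isAffine_of_surjective [Surjective i] [IsAffine Z] : IsAffine Y := by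
  have hmul (t r : Γ(Z, ⊤)) (h : ∃ W, IsAffineOpen W ∧ i ⁻¹ᵁ W = Z.basicOpen t) :
      ∃ W, IsAffineOpen W ∧ i ⁻¹ᵁ W = Z.basicOpen (t * r) := by
    obtain ⟨W, hW, e⟩ := h
    obtain ⟨f, hf⟩ := exists_app_eq_res i hW le_top r
    refine ⟨Y.basicOpen f, hW.basicOpen f, ?_⟩
    rw [Scheme.preimage_basicOpen, hf, Scheme.basicOpen_res, e, Scheme.basicOpen_mul]
  let I : Ideal Γ(Z, ⊤) :=
    { carrier := {t | ∃ W, IsAffineOpen W ∧ i ⁻¹ᵁ W = Z.basicOpen t}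
      zero_mem' := ⟨⊥, isAffineOpen_bot Y, by rw [Scheme.basicOpen_zero]; rfl⟩
      smul_mem' := fun r t h ↦ by rw [smul_eq_mul, mul_comm]; exact hmul t r h
      add_mem' := by
        intro a b ha hb
        obtain ⟨W₁, hW₁, e₁⟩ := hmul a (a + b) ha
        obtain ⟨W₂, hW₂, e₂⟩ := hmul b (a + b) hb
        obtain ⟨W, hW⟩ : ∃ W : Y.Opens, i ⁻¹ᵁ W = Z.basicOpen (a + b) := by
          obtain ⟨O, hO, e⟩ := i.isClosedEmbedding.isInducing.isOpen_iff.mp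
            (Z.basicOpen (a + b)).isOpen
          exact ⟨⟨O, hO⟩, Opens.ext e⟩
        let φ := (Z.presheaf.map (homOfLE (le_top : i ⁻¹ᵁ W ≤ ⊤)).op).hom
        have hu : IsUnit (φ (a + b)) := by
          exact Z.isUnit_res_of_le_basicOpen (a + b) hW.le
        obtain ⟨u, hu⟩ := hu
        let v : Γ(Z, i ⁻¹ᵁ W) := ↑u⁻¹
        have hD (x : Γ(Z, ⊤)) : Z.basicOpen (φ x * v) = Z.basicOpen (x * (a + b)) := by
          rw [Scheme.basicOpen_mul, Z.basicOpen_of_isUnit (f := v) u⁻¹.isUnit, Scheme.basicOpen_mul]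
          change Z.basicOpen (Z.presheaf.map _ x) ⊓ _ = _
          rw [Scheme.basicOpen_res, hW]
          simp [inf_comm]
        refine ⟨W, isAffineOpen_of_preimage_eq_basicOpen i hW₁ hW₂ ?_ ?_ (φ a * v) ?_ ?_, hW⟩
        · rw [← i.preimage_le_preimage_iff, e₁, hW, Scheme.basicOpen_mul]
          exact inf_le_right
        · rw [← i.preimage_le_preimage_iff, e₂, hW, Scheme.basicOpen_mul]
          exact inf_le_right
        · rw [hD, e₁]
        · have : 1 - φ a * v = φ b * v := by
            have : (φ a + φ b) * v = 1 := by rw [← map_add, ← hu]; exact u.mul_inv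
            linear_combination -this
          rw [this, hD, e₂] }
  have hI : I = ⊤ := by
    rw [← Ideal.span_eq I, ← (isAffineOpen_top Z).self_le_iSup_basicOpen_iff]
    intro z _
    obtain ⟨U, hU, hzU, -⟩ := exists_isAffineOpen_mem_and_subset (U := ⊤) (x := i z) trivial
    obtain ⟨t, ht, hzt⟩ := (isAffineOpen_top Z).exists_basicOpen_le (V := i ⁻¹ᵁ U) ⟨z, hzU⟩ trivial
    obtain ⟨f, hf⟩ := exists_app_eq_res i hU le_top t
    refine Opens.mem_iSup.mpr ⟨⟨t, Y.basicOpen f, hU.basicOpen f, ?_⟩, hzt⟩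
    rw [Scheme.preimage_basicOpen, hf, Scheme.basicOpen_res]
    exact inf_eq_right.mpr ht
  obtain ⟨W, hW, e⟩ : (1 : Γ(Z, ⊤)) ∈ I := hI ▸ Submodule.mem_top
  rw [Scheme.basicOpen_one] at e
  obtain rfl : W = ⊤ := i.preimage_injective_of_surjective e
  exact hW.isAffine_of_top

end IsClosedImmersion

namespace Scheme.IdealSheafData

instance isClosedImmersion_inclusion {I J : Y.IdealSheafData} (h : I ≤ J) :
    IsClosedImmersion (inclusion h) :=
  have : IsClosedImmersion (inclusion h ≫ I.subschemeι) := by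
    rw [inclusion_subschemeι]; infer_instance
  .of_comp (inclusion h) I.subschemeι

/-- The inverse system of closed subschemes defined by a set of ideal sheaves. -/
noncomputable def subschemeDiagram (C : Set Y.IdealSheafData) : (↥C)ᵒᵖ ⥤ Scheme.{u} where
  obj c := c.unop.1.subscheme
  map {_ _} h := inclusion h.unop.le

/-- The closed subscheme cut out by `sSup C`, as a cone over `subschemeDiagram C`. -/
noncomputable def subschemeCone (C : Set Y.IdealSheafData) : Cone (subschemeDiagram C) where
  pt := (sSup C).subscheme
  π := { app := fun c ↦ inclusion (le_sSup c.unop.2)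
         naturality := fun _ _ _ ↦ by
          simp [subschemeDiagram] }

/-- `V(sSup C)` is the limit of the `V(I)` for `I` in a directed set `C`. -/
noncomputable def isLimitSubschemeCone (C : Set Y.IdealSheafData) [Nonempty C]
    [IsDirectedOrder C] : IsLimit (subschemeCone C) := by
  let g (s : Cone (subschemeDiagram C)) (c : C) : s.pt ⟶ Y := s.π.app (op c) ≫ c.1.subschemeι
  have hg (s) {c d : C} (h : c ≤ d) : g s c = g s d := by
    have := s.w (homOfLE h).op
    dsimp only [g]
    rw [← this]
    simp [subschemeDiagram]
  have hg' (s) (c d : C) : g s c = g s d := by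
    obtain ⟨e, hc, hd⟩ := exists_ge_ge c d
    rw [hg s hc, hg s hd]
  let c₀ : C := Classical.arbitrary C
  have hle (s) : sSup C ≤ (g s c₀).ker := by
    refine sSup_le fun c hc ↦ ?_
    rw [hg' s c₀ ⟨c, hc⟩]
    exact (ker_subschemeι c).ge.trans (Scheme.Hom.le_ker_comp _ _)
  let l (s : Cone (subschemeDiagram C)) : s.pt ⟶ (sSup C).subscheme :=
    IsClosedImmersion.lift (sSup C).subschemeι (g s c₀)
    ((ker_subschemeι _).trans_le (hle s))
  have hl (s) : l s ≫ (sSup C).subschemeι = g s c₀ := IsClosedImmersion.lift_fac _ _ _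
  refine
    { lift := l
      fac := fun s c ↦ ?_
      uniq := fun s m hm ↦ ?_ }
  · refine (cancel_mono c.unop.1.subschemeι).mp (Eq.trans ?_ (hg' s c₀ c.unop))
    rw [← hl]
    exact (Category.assoc _ _ _).trans (congrArg (l s ≫ ·) (inclusion_subschemeι _))
  · refine (cancel_mono (sSup C).subschemeι).mp (Eq.trans ?_ (hl s).symm)
    simp only [g]
    rw [← hm (op c₀)]
    exact ((Category.assoc _ _ _).trans (congrArg (m ≫ ·) (inclusion_subschemeι _))).symm

theorem exists_maximal_not_isAffine_subscheme [CompactSpace Y] [QuasiSeparatedSpace Y]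
    (hY : ¬ IsAffine Y) :
    ∃ I : Y.IdealSheafData, ¬ IsAffine I.subscheme ∧ ∀ J, I < J → IsAffine J.subscheme := by
  have hsSup (C) (hC : C ⊆ {I : Y.IdealSheafData | ¬ IsAffine I.subscheme})
      (hchain : IsChain (· ≤ ·) C) (I) (hI : I ∈ C) : ¬ IsAffine (sSup C).subscheme := by
    intro h
    have : Nonempty C := ⟨I, hI⟩
    have : IsDirectedOrder C := ⟨hchain.directed⟩
    have {i j : (↥C)ᵒᵖ} (f : i ⟶ j) : IsAffineHom ((subschemeDiagram C).map f) := by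
      dsimp [subschemeDiagram]; infer_instance
    have (i : (↥C)ᵒᵖ) : CompactSpace ((subschemeDiagram C).obj i) :=
      let I := i.unop.1
      show CompactSpace I.subscheme from QuasiCompact.compactSpace_of_compactSpace I.subschemeι
    have (i : (↥C)ᵒᵖ) : QuasiSeparatedSpace ((subschemeDiagram C).obj i) :=
      let I := i.unop.1
      show QuasiSeparatedSpace I.subscheme from quasiSeparatedSpace_of_quasiSeparated I.subschemeι
    have : IsAffine (subschemeCone C).pt := h
    obtain ⟨i, hi⟩ := Scheme.exists_isAffine_of_isLimit _ _ (isLimitSubschemeCone C)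
    exact hC i.unop.2 hi
  obtain ⟨I, -, hI⟩ := zorn_le_nonempty₀ {I : Y.IdealSheafData | ¬ IsAffine I.subscheme}
    (fun C hC hchain I hI ↦ ⟨sSup C, hsSup C hC hchain I hI, fun _ ↦ le_sSup⟩) ⊥
    (fun h ↦ hY (.of_isIso (inv (subschemeι (⊥ : Y.IdealSheafData)))))
  refine ⟨I, hI.1, fun J hJ ↦ ?_⟩
  by_contra h
  exact hJ.not_ge (hI.2 h hJ.le)

end Scheme.IdealSheafData

theorem Scheme.Hom.compactSpace_of_surjective (f : X ⟶ Y) [Surjective f] [CompactSpace X] :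
    CompactSpace Y :=
  ⟨by simpa [f.surjective.range_eq] using isCompact_range f.continuous⟩

theorem Scheme.Hom.quasiSeparatedSpace_of_surjective (f : X ⟶ Y) [IsAffineHom f] [Surjective f]
    [IsAffine X] : QuasiSeparatedSpace Y := by
  rw [quasiSeparatedSpace_iff_forall_affineOpens]
  intro U V
  have h := (quasiSeparatedSpace_iff_forall_affineOpens.mp (inferInstanceAs (QuasiSeparatedSpace X))
    ⟨_, U.2.preimage f⟩ ⟨_, V.2.preimage f⟩).image f.continuous
  exact (Set.image_preimage_eq ((U.1 : Set Y) ∩ V.1) f.surjective) ▸ h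

namespace Scheme.IdealSheafData

theorem isAffine_subscheme_of_forall_gt {I : Y.IdealSheafData}
    (hI : ∀ J, I < J → IsAffine J.subscheme) (K : I.subscheme.IdealSheafData) (hK : K ≠ ⊥) :
    IsAffine K.subscheme := by
  let i := K.subschemeι ≫ I.subschemeι
  have hle : I ≤ i.ker := (ker_subschemeι I).ge.trans (Scheme.Hom.le_ker_comp _ _)
  have hne : I ≠ i.ker := by
    intro h
    apply hK
    have := IsClosedImmersion.isIso_of_ker_eq i I.subschemeι K.subschemeι rfl
      (h.symm.trans (ker_subschemeι I).symm)
    exact (isIso_subschemeι_iff_eq_bot K).mp this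
  have := hI _ (lt_of_le_of_ne hle hne)
  have := IsClosedImmersion.isIso_lift i i.ker.subschemeι (ker_subschemeι _).symm
  exact .of_isIso (inv (IsClosedImmersion.lift i i.ker.subschemeι (ker_subschemeι _).ge))

end Scheme.IdealSheafData

/-- Noetherian induction: to descend affineness along finite surjective morphisms one may assume
that all proper closed subschemes of the target are affine. -/
theorem isAffine_of_minimal
    (H : ∀ {X Y : Scheme.{u}} (f : X ⟶ Y) [IsFinite f] [Surjective f] [IsAffine X],
      (∀ K : Y.IdealSheafData, K ≠ ⊥ → IsAffine K.subscheme) → IsAffine Y)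
    (f : X ⟶ Y) [IsFinite f] [Surjective f] [IsAffine X] : IsAffine Y := by
  have := f.compactSpace_of_surjective
  have := f.quasiSeparatedSpace_of_surjective
  by_contra hY
  obtain ⟨I, hI, hI'⟩ := Scheme.IdealSheafData.exists_maximal_not_isAffine_subscheme hY
  have : IsAffine (pullback f I.subschemeι) := isAffine_of_isAffineHom (pullback.fst f I.subschemeι)
  exact hI (H (pullback.snd f I.subschemeι)
    (Scheme.IdealSheafData.isAffine_subscheme_of_forall_gt hI'))

theorem Scheme.eq_zero_of_forall_affineOpens {U : Y.Opens} (s : Γ(Y, U))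
    (hs : ∀ (V : Y.Opens) (h : V ≤ U), IsAffineOpen V → Y.presheaf.map (homOfLE h).op s = 0) :
    s = 0 := by
  refine Y.sheaf.eq_of_locally_eq' (ι := {V : Y.Opens // V ≤ U ∧ IsAffineOpen V})
    (fun V ↦ V.1) U (fun V ↦ homOfLE V.2.1) (fun x hx ↦ ?_) s 0 fun V ↦ ?_
  · obtain ⟨V, hV, hxV, hVU⟩ := exists_isAffineOpen_mem_and_subset hx
    exact Opens.mem_iSup.mpr ⟨⟨V, hVU, hV⟩, hxV⟩
  · exact (hs V.1 V.2.1 V.2.2).trans (map_zero (Y.presheaf.map (homOfLE V.2.1).op).hom).symm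

theorem Scheme.isReduced_of_nilradical_eq_bot (h : Y.nilradical = ⊥) : IsReduced Y where
  component_reduced U := by
    refine ⟨fun s hs ↦ Y.eq_zero_of_forall_affineOpens s fun V hVU hV ↦ ?_⟩
    have h' : Y.nilradical.ideal ⟨V, hV⟩ = ⊥ := by rw [h]; rfl
    have h₂ : Y.presheaf.map (homOfLE hVU).op s ∈ Y.nilradical.ideal ⟨V, hV⟩ :=
      hs.map (Y.presheaf.map (homOfLE hVU).op).hom
    rwa [h'] at h₂

theorem isReduced_or_isAffine_of_minimal
    (H : ∀ K : Y.IdealSheafData, K ≠ ⊥ → IsAffine K.subscheme) : IsReduced Y ∨ IsAffine Y := by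
  by_cases h : Y.nilradical = ⊥
  · exact .inl (Scheme.isReduced_of_nilradical_eq_bot h)
  · right
    have := H _ h
    have : Surjective Y.nilradical.subschemeι := ⟨by
      rw [← Set.range_eq_univ, Scheme.IdealSheafData.range_subschemeι, Scheme.support_nilradical]
      rfl⟩
    exact IsClosedImmersion.isAffine_of_surjective Y.nilradical.subschemeι

theorem Scheme.Hom.app_eq_res_appTop {Z Z' : Scheme.{u}} (j : Z' ⟶ Z) (i : Z ⟶ Y) (k : Z' ⟶ Y)
    (h : j ≫ i = k) {V : Y.Opens} (a : Γ(Y, V)) (t : Γ(Z, ⊤))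
    (ha : i.app V a = Z.presheaf.map (homOfLE le_top).op t) :
    k.app V a = Z'.presheaf.map (homOfLE le_top).op (j.appTop t) := by
  subst h
  have := congr(j.app _ $ha)
  rw [Scheme.Hom.comp_app]
  exact this.trans (ConcreteCategory.congr_hom (j.naturality (homOfLE le_top).op) t)

theorem Scheme.Hom.app_res_appTop (i : X ⟶ Y) (V : Y.Opens) (t : Γ(Y, ⊤)) :
    i.app V (Y.presheaf.map (homOfLE le_top).op t) =
      X.presheaf.map (homOfLE le_top).op (i.appTop t) :=
  ConcreteCategory.congr_hom (i.naturality (homOfLE le_top).op) t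

theorem Scheme.res_res {U V W : Y.Opens} (h : V ≤ U) (h' : W ≤ V) (s : Γ(Y, U)) :
    Y.presheaf.map (homOfLE h').op (Y.presheaf.map (homOfLE h).op s) =
      Y.presheaf.map (homOfLE (h'.trans h)).op s :=
  (ConcreteCategory.congr_hom (Y.presheaf.map_comp (homOfLE h).op (homOfLE h').op) s).symm

theorem Scheme.Hom.app_res (i : X ⟶ Y) {V W : Y.Opens} (h : W ≤ V) (s : Γ(Y, V)) :
    i.app W (Y.presheaf.map (homOfLE h).op s) =
      X.presheaf.map (homOfLE (i.preimage_mono h)).op (i.app V s) :=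
  ConcreteCategory.congr_hom (i.naturality (homOfLE h).op) s

/-- Sections on affine opens that are compatible on smaller affine opens glue. -/
theorem Scheme.exists_appTop_of_affineOpens (t : ∀ V : Y.affineOpens, Γ(Y, V))
    (ht : ∀ (V W : Y.affineOpens) (h : W.1 ≤ V.1), Y.presheaf.map (homOfLE h).op (t V) = t W) :
    ∃ s : Γ(Y, ⊤), ∀ V : Y.affineOpens, Y.presheaf.map (homOfLE le_top).op s = t V := by
  obtain ⟨s, hs, -⟩ := Y.sheaf.existsUnique_gluing' (fun V : Y.affineOpens ↦ V.1) ⊤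
    (fun V ↦ homOfLE le_top) (fun x hx ↦ by
      obtain ⟨V, hV, hxV, -⟩ := exists_isAffineOpen_mem_and_subset hx
      exact Opens.mem_iSup.mpr ⟨⟨V, hV⟩, hxV⟩) t (by
      intro V W
      rw [← sub_eq_zero]
      refine Y.eq_zero_of_forall_affineOpens _ fun O hO hO' ↦ ?_
      refine (map_sub (Y.presheaf.map (homOfLE hO).op).hom _ _).trans (sub_eq_zero.mpr ?_)
      refine (Y.res_res _ _ _).trans (Eq.trans ?_ (Y.res_res _ _ _).symm)
      exact (ht V ⟨O, hO'⟩ _).trans (ht W ⟨O, hO'⟩ _).symm)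
  exact ⟨s, hs⟩

namespace Scheme.IdealSheafData

variable {I₁ I₂ : Y.IdealSheafData}

theorem eq_zero_of_inf_eq_bot (h : I₁ ⊓ I₂ = ⊥) {U : Y.Opens} (s : Γ(Y, U))
    (h₁ : I₁.subschemeι.app U s = 0) (h₂ : I₂.subschemeι.app U s = 0) : s = 0 := by
  refine Y.eq_zero_of_forall_affineOpens s fun V hVU hV ↦ ?_
  have key (I : Y.IdealSheafData) (hI : I.subschemeι.app U s = 0) :
      Y.presheaf.map (homOfLE hVU).op s ∈ I.ideal ⟨V, hV⟩ := by
    rw [← ker_subschemeι_app]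
    refine (I.subschemeι.app_res hVU s).trans ?_
    rw [hI, map_zero]
  have : Y.presheaf.map (homOfLE hVU).op s ∈ (I₁ ⊓ I₂).ideal ⟨V, hV⟩ := ⟨key _ h₁, key _ h₂⟩
  rwa [h] at this

theorem exists_appTop_eq (h : I₁ ⊓ I₂ = ⊥) (t₁ : Γ(I₁.subscheme, ⊤)) (t₂ : Γ(I₂.subscheme, ⊤))
    (ht : (inclusion (le_sup_left : I₁ ≤ I₁ ⊔ I₂)).appTop t₁ =
      (inclusion (le_sup_right : I₂ ≤ I₁ ⊔ I₂)).appTop t₂) :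
    ∃ t : Γ(Y, ⊤), I₁.subschemeι.appTop t = t₁ ∧ I₂.subschemeι.appTop t = t₂ := by
  have key (V : Y.affineOpens) : ∃ a : Γ(Y, V),
      I₁.subschemeι.app V a = I₁.subscheme.presheaf.map (homOfLE le_top).op t₁ ∧
      I₂.subschemeι.app V a = I₂.subscheme.presheaf.map (homOfLE le_top).op t₂ := by
    obtain ⟨a₁, h₁⟩ := I₁.subschemeι_app_surjective V
      (I₁.subscheme.presheaf.map (homOfLE le_top).op t₁)
    obtain ⟨a₂, h₂⟩ := I₂.subschemeι_app_surjective V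
      (I₂.subscheme.presheaf.map (homOfLE le_top).op t₂)
    have e₁ := Scheme.Hom.app_eq_res_appTop _ _ _
      (inclusion_subschemeι (le_sup_left : I₁ ≤ I₁ ⊔ I₂)) a₁ t₁ h₁
    have e₂ := Scheme.Hom.app_eq_res_appTop _ _ _
      (inclusion_subschemeι (le_sup_right : I₂ ≤ I₁ ⊔ I₂)) a₂ t₂ h₂
    have : a₁ - a₂ ∈ (I₁ ⊔ I₂).ideal V := by
      rw [← ker_subschemeι_app, RingHom.mem_ker, map_sub, sub_eq_zero]
      exact e₁.trans ((ht ▸ rfl : _ = _).trans e₂.symm)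
    obtain ⟨u₁, hu₁, u₂, hu₂, hu⟩ := Submodule.mem_sup.mp this
    rw [← ker_subschemeι_app, RingHom.mem_ker] at hu₁ hu₂
    refine ⟨a₁ - u₁, ?_, ?_⟩
    · exact (map_sub (I₁.subschemeι.app V).hom _ _).trans (by rw [hu₁, sub_zero]; exact h₁)
    · rw [show a₁ - u₁ = a₂ + u₂ by linear_combination -hu]
      exact (map_add (I₂.subschemeι.app V).hom _ _).trans (by rw [hu₂, add_zero]; exact h₂)
  choose a ha₁ ha₂ using key
  obtain ⟨s, hs⟩ := Y.exists_appTop_of_affineOpens a (by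
    intro V W hWV
    rw [← sub_eq_zero]
    refine eq_zero_of_inf_eq_bot h _ ?_ ?_
    · rw [map_sub, Scheme.Hom.app_res, ha₁, ha₁, Scheme.res_res, sub_self]
    · rw [map_sub, Scheme.Hom.app_res, ha₂, ha₂, Scheme.res_res, sub_self])
  have hcov (I : Y.IdealSheafData) (t : Γ(I.subscheme, ⊤)) (h : ∀ V : Y.affineOpens,
      I.subschemeι.app V (a V) = I.subscheme.presheaf.map (homOfLE le_top).op t) :
      I.subschemeι.appTop s = t := by
    refine I.subscheme.sheaf.eq_of_locally_eq' (fun V : Y.affineOpens ↦ I.subschemeι ⁻¹ᵁ V.1) ⊤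
      (fun V ↦ homOfLE le_top) (fun x hx ↦ ?_) _ _ fun V ↦ ?_
    · obtain ⟨V, hV, hxV, -⟩ := exists_isAffineOpen_mem_and_subset
        (U := ⊤) (x := I.subschemeι x) trivial
      exact Opens.mem_iSup.mpr ⟨⟨V, hV⟩, hxV⟩
    · refine Eq.trans ?_ (h V)
      rw [← hs V, Scheme.Hom.app_res_appTop]
      rfl
  exact ⟨s, hcov I₁ t₁ ha₁, hcov I₂ t₂ ha₂⟩

end Scheme.IdealSheafData

theorem IsAffineOpen.basicOpen_of_le {U : Y.Opens} (hU : IsAffineOpen U) (s : Γ(Y, ⊤))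
    (h : Y.basicOpen s ≤ U) : IsAffineOpen (Y.basicOpen s) := by
  have := hU.basicOpen (Y.presheaf.map (homOfLE le_top).op s)
  rwa [Scheme.basicOpen_res, inf_eq_right.mpr h] at this

theorem Scheme.exists_appTop_eq_zero_mem_basicOpen [IsAffine Y] [CompactSpace X] (j : X ⟶ Y)
    (O : Y.Opens) (hO : Disjoint (O : Set Y) (Set.range j)) (z : Y) (hz : z ∈ O) :
    ∃ t : Γ(Y, ⊤), j.appTop t = 0 ∧ z ∈ Y.basicOpen t := by
  obtain ⟨t, ht, hzt⟩ := (isAffineOpen_top Y).exists_basicOpen_le (V := O) ⟨z, hz⟩ trivial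
  have : IsNilpotent (j.appTop t) := by
    rw [Scheme.isNilpotent_iff_basicOpen_eq_bot, ← Scheme.preimage_basicOpen_top, eq_bot_iff]
    intro x hx
    exact (Set.disjoint_left.mp hO (ht hx) ⟨x, rfl⟩).elim
  obtain ⟨n, hn⟩ := this
  refine ⟨t ^ (n + 1), by rw [map_pow, pow_succ, hn, zero_mul], ?_⟩
  rw [show Y.basicOpen (t ^ (n + 1)) = Y.basicOpen t from RingedSpace.basicOpen_pow _ t _ n.succ_pos]
  exact hzt

namespace Scheme.IdealSheafData

variable {I₁ I₂ : Y.IdealSheafData}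

theorem appTop_subschemeι_surjective (h : I₁ ⊓ I₂ = ⊥) [IsAffine I₂.subscheme] :
    Function.Surjective I₁.subschemeι.appTop := by
  intro t₁
  obtain ⟨t₂, ht₂⟩ := (inclusion (le_sup_right : I₂ ≤ I₁ ⊔ I₂)).app_surjective ⊤
    (isAffineOpen_top _) ((inclusion (le_sup_left : I₁ ≤ I₁ ⊔ I₂)).appTop t₁)
  obtain ⟨t, ht, -⟩ := exists_appTop_eq h t₁ t₂ ht₂.symm
  exact ⟨t, ht⟩

theorem mem_support_or_mem_support (h : I₁ ⊓ I₂ = ⊥) (y : Y) :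
    y ∈ I₁.support ∨ y ∈ I₂.support := by
  have h' : I₁ * I₂ = ⊥ := eq_bot_iff.mpr (h ▸ fun _ ↦ Ideal.mul_le_inf)
  have : y ∈ (I₁ * I₂).support := by rw [h', support_bot]; trivial
  rwa [support_mul] at this

theorem exists_eq_subschemeι (I : Y.IdealSheafData) {y : Y} (hy : y ∈ I.support) :
    ∃ z, I.subschemeι z = y := by
  rw [← SetLike.mem_coe, ← range_subschemeι] at hy
  exact hy

theorem exists_preimage_basicOpen_le (h : I₁ ⊓ I₂ = ⊥) [IsAffine I₁.subscheme]
    [IsAffine I₂.subscheme] (U : Y.Opens) (y : Y) (hy : y ∈ U) :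
    ∃ s : Γ(Y, ⊤), y ∈ Y.basicOpen s ∧
      I₁.subschemeι ⁻¹ᵁ Y.basicOpen s ≤ I₁.subschemeι ⁻¹ᵁ U := by
  by_cases hy₁ : y ∈ I₁.support
  · obtain ⟨z, rfl⟩ := exists_eq_subschemeι _ hy₁
    obtain ⟨t, ht, hzt⟩ := (isAffineOpen_top _).exists_basicOpen_le
      (V := I₁.subschemeι ⁻¹ᵁ U) ⟨z, hy⟩ trivial
    obtain ⟨s, rfl⟩ := appTop_subschemeι_surjective h t
    rw [← Scheme.preimage_basicOpen_top] at ht hzt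
    exact ⟨s, hzt, ht⟩
  · obtain ⟨z, rfl⟩ := exists_eq_subschemeι _ ((mem_support_or_mem_support h y).resolve_left hy₁)
    have : IsAffine (I₁ ⊔ I₂).subscheme :=
      isAffine_of_isAffineHom (inclusion (le_sup_right : I₂ ≤ I₁ ⊔ I₂))
    obtain ⟨t, ht, hzt⟩ := exists_appTop_eq_zero_mem_basicOpen
      (inclusion (le_sup_right : I₂ ≤ I₁ ⊔ I₂))
      (I₂.subschemeι ⁻¹ᵁ I₁.support.compl) (by
        rw [Set.disjoint_left]
        rintro _ hx ⟨x, rfl⟩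
        refine hx ?_
        rw [← Scheme.Hom.comp_apply, inclusion_subschemeι,
          ← inclusion_subschemeι (le_sup_left : I₁ ≤ I₁ ⊔ I₂), Scheme.Hom.comp_apply,
          ← range_subschemeι]
        exact ⟨_, rfl⟩) z hy₁
    obtain ⟨s, hs₁, hs₂⟩ := exists_appTop_eq h 0 t (by rw [ht, map_zero])
    refine ⟨s, ?_, ?_⟩
    · rw [← hs₂, ← Scheme.preimage_basicOpen_top] at hzt
      exact hzt
    · rw [Scheme.preimage_basicOpen_top, hs₁, Scheme.basicOpen_zero]
      exact bot_le

theorem exists_mem_basicOpen_le (h : I₁ ⊓ I₂ = ⊥) [IsAffine I₁.subscheme]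
    [IsAffine I₂.subscheme] (U : Y.Opens) (y : Y) (hy : y ∈ U) :
    ∃ s : Γ(Y, ⊤), y ∈ Y.basicOpen s ∧ Y.basicOpen s ≤ U := by
  obtain ⟨s₁, hy₁, h₁⟩ := exists_preimage_basicOpen_le h U y hy
  obtain ⟨s₂, hy₂, h₂⟩ := exists_preimage_basicOpen_le ((inf_comm _ _).trans h) U y hy
  refine ⟨s₁ * s₂, by rw [Scheme.basicOpen_mul]; exact ⟨hy₁, hy₂⟩, fun x hx ↦ ?_⟩
  rw [Scheme.basicOpen_mul] at hx
  obtain hx' | hx' := mem_support_or_mem_support h x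
  · obtain ⟨z, rfl⟩ := exists_eq_subschemeι _ hx'
    exact h₁ hx.1
  · obtain ⟨z, rfl⟩ := exists_eq_subschemeι _ hx'
    exact h₂ hx.2

theorem isAffine_of_inf_eq_bot (h : I₁ ⊓ I₂ = ⊥) [IsAffine I₁.subscheme]
    [IsAffine I₂.subscheme] : IsAffine Y := by
  let S : Set Γ(Y, ⊤) := {s | IsAffineOpen (Y.basicOpen s)}
  have hS (y : Y) : ∃ s ∈ S, y ∈ Y.basicOpen s := by
    obtain ⟨U, hU, hyU, -⟩ := exists_isAffineOpen_mem_and_subset (U := ⊤) (x := y) trivial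
    obtain ⟨s, hs, hsU⟩ := exists_mem_basicOpen_le h U y hyU
    exact ⟨s, hU.basicOpen_of_le s hsU, hs⟩
  have key (I : Y.IdealSheafData) [IsAffine I.subscheme]
      (hsurj : Function.Surjective I.subschemeι.appTop) :
      ∃ a ∈ Ideal.span S, I.subschemeι.appTop a = 1 := by
    have : (Ideal.span S).map I.subschemeι.appTop.hom = ⊤ := by
      rw [Ideal.map_span, ← (isAffineOpen_top I.subscheme).self_le_iSup_basicOpen_iff]
      intro z _
      obtain ⟨s, hs, hy⟩ := hS (I.subschemeι z)
      refine Opens.mem_iSup.mpr ⟨⟨_, s, hs, rfl⟩, ?_⟩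
      have : z ∈ I.subschemeι ⁻¹ᵁ Y.basicOpen s := hy
      rwa [Scheme.preimage_basicOpen_top] at this
    exact (Ideal.mem_map_iff_of_surjective _ hsurj).mp (this ▸ Submodule.mem_top)
  obtain ⟨a₁, ha₁, e₁⟩ := key I₁ (appTop_subschemeι_surjective h)
  obtain ⟨a₂, ha₂, e₂⟩ := key I₂ (appTop_subschemeι_surjective ((inf_comm _ _).trans h))
  have h0 : (1 - a₁) * (1 - a₂) = 0 := by
    refine eq_zero_of_inf_eq_bot h _ ?_ ?_
    · refine (map_mul I₁.subschemeι.appTop.hom _ _).trans ?_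
      rw [map_sub, map_one]
      change (1 - I₁.subschemeι.appTop a₁) * _ = 0
      rw [e₁, sub_self, zero_mul]
    · refine (map_mul I₂.subschemeι.appTop.hom _ _).trans ?_
      rw [map_sub _ 1 a₂, map_one]
      change _ * (1 - I₂.subschemeι.appTop a₂) = 0
      rw [e₂, sub_self, mul_zero]
  refine isAffine_of_isAffineOpen_basicOpen S ?_ fun _ ↦ id
  rw [Ideal.eq_top_iff_one, show (1 : Γ(Y, ⊤)) = a₁ + (1 - a₁) * a₂ by linear_combination h0]
  exact add_mem ha₁ (Ideal.mul_mem_left _ _ ha₂)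

end Scheme.IdealSheafData

/-- If all proper closed subschemes of a scheme are affine, then it is affine or integral. -/
theorem isIntegral_or_isAffine_of_minimal
    (H : ∀ K : Y.IdealSheafData, K ≠ ⊥ → IsAffine K.subscheme) : IsIntegral Y ∨ IsAffine Y := by
  obtain h | h := isReduced_or_isAffine_of_minimal H
  swap
  · exact .inr h
  obtain hE | hE := isEmpty_or_nonempty Y
  · exact .inr inferInstance
  by_cases hirr : IrreducibleSpace Y
  · exact .inl (isIntegral_of_irreducibleSpace_of_isReduced Y)
  right
  have : ¬ IsPreirreducible (Set.univ : Set Y) := fun h ↦ hirr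
    { isPreirreducible_univ := h, toNonempty := hE }
  rw [isPreirreducible_iff_isClosed_union_isClosed] at this
  push Not at this
  obtain ⟨Z₁, Z₂, hZ₁, hZ₂, hZ, h₁, h₂⟩ := this
  let I₁ := Scheme.IdealSheafData.vanishingIdeal (X := Y) ⟨Z₁, hZ₁⟩
  let I₂ := Scheme.IdealSheafData.vanishingIdeal (X := Y) ⟨Z₂, hZ₂⟩
  have hne (Z : Closeds Y) (hZ : ¬ Set.univ ⊆ (Z : Set Y)) :
      Scheme.IdealSheafData.vanishingIdeal Z ≠ ⊥ := by
    intro h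
    apply hZ
    rw [← Scheme.IdealSheafData.coe_support_vanishingIdeal, h, Scheme.IdealSheafData.support_bot]
    exact subset_rfl
  have := H I₁ (hne _ h₁)
  have := H I₂ (hne _ h₂)
  refine Scheme.IdealSheafData.isAffine_of_inf_eq_bot (I₁ := I₁) (I₂ := I₂) ?_
  rw [← Scheme.IdealSheafData.vanishingIdeal_sup, ← Scheme.nilradical_eq_bot,
    ← Scheme.IdealSheafData.vanishingIdeal_top]
  congr
  exact top_le_iff.mp hZ

theorem Scheme.genericPoint_mem [IrreducibleSpace Y] (U : Y.Opens) [h : Nonempty U] :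
    genericPoint Y ∈ U :=
  ((genericPoint_spec Y).mem_open_set_iff U.isOpen).mpr (by simpa using h)

theorem Scheme.Hom.apply_genericPoint [IrreducibleSpace X] [IrreducibleSpace Y] (f : X ⟶ Y)
    [Surjective f] : f (genericPoint X) = genericPoint Y := by
  have := (genericPoint_spec X).image f.continuous
  rw [Set.image_univ, f.surjective.range_eq, closure_univ] at this
  exact this.eq (genericPoint_spec Y)

theorem Scheme.Hom.nonempty_preimage (f : X ⟶ Y) [Surjective f] (U : Y.Opens) [h : Nonempty U] :
    Nonempty (f ⁻¹ᵁ U) := by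
  obtain ⟨y, hy⟩ := h
  obtain ⟨x, rfl⟩ := f.surjective y
  exact ⟨⟨x, hy⟩⟩

theorem Scheme.Hom.exists_functionField_map [IsIntegral X] [IsIntegral Y] (f : X ⟶ Y)
    [Surjective f] : ∃ φ : Y.functionField →+* X.functionField,
      ∀ (U : Y.Opens) [Nonempty U] [Nonempty (f ⁻¹ᵁ U)] (s : Γ(Y, U)),
        φ (Y.germToFunctionField U s) = X.germToFunctionField (f ⁻¹ᵁ U) (f.app U s) := by
  have h : f (genericPoint X) ⤳ genericPoint Y := specializes_of_eq f.apply_genericPoint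
  refine ⟨(Y.presheaf.stalkSpecializes h ≫ f.stalkMap _).hom, fun U _ _ s ↦ ?_⟩
  have hU := Scheme.genericPoint_mem U
  have hfU : f (genericPoint X) ∈ U := f.apply_genericPoint ▸ hU
  have := Y.presheaf.germ_stalkSpecializes_assoc hU h (f.stalkMap _)
  rw [Scheme.Hom.germ_stalkMap] at this
  exact congr($this s)

theorem germToFunctionField_res [IrreducibleSpace Y] {U V : Y.Opens} [Nonempty U] [Nonempty V]
    (h : U ≤ V) (s : Γ(Y, V)) :
    Y.germToFunctionField U (Y.presheaf.map (homOfLE h).op s) = Y.germToFunctionField V s :=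
  Y.presheaf.germ_res_apply (homOfLE h) _ _ s

instance [Nonempty Y] : Nonempty (⊤ : Y.Opens) := ⟨⟨Classical.arbitrary _, trivial⟩⟩

theorem exists_germToFunctionField_top_eq [IsIntegral Y] (c : Y.functionField)
    (h : ∀ y, ∃ (U : Y.Opens) (_ : Nonempty U), y ∈ U ∧ ∃ s, Y.germToFunctionField U s = c) :
    ∃ s, Y.germToFunctionField ⊤ s = c := by
  choose U hU hy s hs using h
  have hne (U V : Y.Opens) [Nonempty U] [Nonempty V] : Nonempty (U ⊓ V : Y.Opens) :=
    ⟨⟨_, Scheme.genericPoint_mem U, Scheme.genericPoint_mem V⟩⟩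
  obtain ⟨a, ha, -⟩ := Y.sheaf.existsUnique_gluing' U ⊤ (fun y ↦ homOfLE le_top)
    (fun y _ ↦ Opens.mem_iSup.mpr ⟨y, hy y⟩) s (fun y z ↦ by
      have := hne (U y) (U z)
      apply Y.germToFunctionField_injective (U y ⊓ U z)
      exact (germToFunctionField_res _ _).trans
        ((hs y).trans ((hs z).symm.trans (germToFunctionField_res _ _).symm)))
  refine ⟨a, ?_⟩
  rw [← hs (genericPoint Y), ← ha]
  exact (germToFunctionField_res _ _).symm

theorem Scheme.Hom.exists_charpoly [IsIntegral X] [IsIntegral Y] (f : X ⟶ Y) [IsFinite f]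
    [Surjective f] : ∃ (φ : Y.functionField →+* X.functionField) (n : ℕ)
      (q : Γ(X, ⊤) → Polynomial Y.functionField),
      (∀ (U : Y.Opens) [Nonempty U] [Nonempty (f ⁻¹ᵁ U)] (s : Γ(Y, U)),
        φ (Y.germToFunctionField U s) = X.germToFunctionField (f ⁻¹ᵁ U) (f.app U s)) ∧
      n ≠ 0 ∧
      (∀ b, (q b).Monic ∧ (q b).eval₂ φ (X.germToFunctionField ⊤ b) = 0) ∧
      ∀ (V : Y.affineOpens) [Nonempty V.1], ∃ h : Γ(Y, V), h ≠ 0 ∧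
        ∀ (I : Ideal Γ(Y, V)) (t : Γ(Y, V)) (b : Γ(X, ⊤)),
          X.presheaf.map (homOfLE le_top).op b - f.app V t ∈
            (Ideal.span {h} * I).map (f.app V).hom →
          ∃ p : Polynomial Γ(Y, V), p.map (Y.germToFunctionField V.1).hom = q b ∧
            p.coeff 0 - (-t) ^ n ∈ I := by
  obtain ⟨φ, hφ⟩ := f.exists_functionField_map
  let : Algebra Y.functionField X.functionField := φ.toAlgebra
  have inj (V : Y.Opens) [Nonempty V] : Function.Injective (f.app V) := by
    have := f.nonempty_preimage V
    have h := φ.injective.comp (Y.germToFunctionField_injective V)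
    rw [show φ ∘ _ = X.germToFunctionField (f ⁻¹ᵁ V) ∘ f.app V from funext fun s ↦ hφ V s] at h
    exact h.of_comp
  have fin (V : Y.affineOpens) : (f.app V).hom.Finite := f.finite_app V V.2
  have frY (V : Y.affineOpens) [Nonempty V.1] :=
    functionField_isFractionRing_of_isAffineOpen Y V.1 V.2
  have frX (V : Y.affineOpens) [Nonempty (f ⁻¹ᵁ V.1)] :=
    functionField_isFractionRing_of_isAffineOpen X (f ⁻¹ᵁ V.1) (V.2.preimage f)
  have : Module.Finite Y.functionField X.functionField := by
    obtain ⟨U, hU, hyU, -⟩ := exists_isAffineOpen_mem_and_subset (U := ⊤)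
      (x := genericPoint Y) trivial
    let V : Y.affineOpens := ⟨U, hU⟩
    have : Nonempty V.1 := ⟨⟨_, hyU⟩⟩
    have := f.nonempty_preimage V.1
    have := frY V
    have := frX V
    exact (fin V).finite_of_isFractionRing Y.functionField X.functionField (inj V) (hφ V.1)
  refine ⟨φ, Module.finrank Y.functionField X.functionField,
    fun b ↦ (Algebra.lmul Y.functionField X.functionField (X.germToFunctionField ⊤ b)).charpoly,
    hφ, Module.finrank_pos.ne', fun b ↦ ⟨LinearMap.charpoly_monic _, ?_⟩, fun V _ ↦ ?_⟩
  · have := LinearMap.aeval_self_charpoly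
      (Algebra.lmul Y.functionField X.functionField (X.germToFunctionField ⊤ b))
    rw [Polynomial.aeval_algHom_apply] at this
    exact (map_eq_zero_iff _ Algebra.lmul_injective).mp this
  · have := f.nonempty_preimage V.1
    have := frY V
    have := frX V
    obtain ⟨h, h0, H⟩ := (fin V).exists_charpoly_eq_map Y.functionField X.functionField (inj V)
      (hφ V.1)
    refine ⟨h, h0, fun I t b hb ↦ ?_⟩
    obtain ⟨p, hp, hp'⟩ := H I t _ hb
    refine ⟨p, hp.trans ?_, hp'⟩
    congr 2
    exact germToFunctionField_res _ _

/-- The closed subscheme of an affine open subscheme defined by an ideal. -/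
noncomputable def IsAffineOpen.fromSpecQuotient {V : Y.Opens} (hV : IsAffineOpen V)
    (I : Ideal Γ(Y, V)) : Spec (.of (Γ(Y, V) ⧸ I)) ⟶ Y :=
  Spec.map (CommRingCat.ofHom (Ideal.Quotient.mk I)) ≫ hV.fromSpec

instance {V : Y.Opens} (hV : IsAffineOpen V) [QuasiSeparatedSpace Y] (I : Ideal Γ(Y, V)) :
    QuasiCompact (hV.fromSpecQuotient I) := by
  delta IsAffineOpen.fromSpecQuotient
  infer_instance

theorem IsAffineOpen.preimage_fromSpecQuotient {V : Y.Opens} (hV : IsAffineOpen V)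
    (I : Ideal Γ(Y, V)) : hV.fromSpecQuotient I ⁻¹ᵁ V = ⊤ := by
  delta fromSpecQuotient
  rw [Scheme.Hom.comp_preimage, hV.fromSpec_preimage_self, Scheme.Hom.preimage_top]

theorem IsAffineOpen.fromSpecQuotient_appLE {V : Y.Opens} (hV : IsAffineOpen V)
    (I : Ideal Γ(Y, V)) :
    (hV.fromSpecQuotient I).appLE V ⊤ (hV.preimage_fromSpecQuotient I).ge ≫
      (Scheme.ΓSpecIso _).hom = CommRingCat.ofHom (Ideal.Quotient.mk I) := by
  have e : ⊤ ≤ Spec.map (CommRingCat.ofHom (Ideal.Quotient.mk I)) ⁻¹ᵁ (hV.fromSpec ⁻¹ᵁ V) :=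
    (hV.preimage_fromSpecQuotient I).ge
  have h : (hV.fromSpecQuotient I).appLE V ⊤ (hV.preimage_fromSpecQuotient I).ge =
      CommRingCat.ofHom (Ideal.Quotient.mk I) ≫ (Scheme.ΓSpecIso _).inv := by
    refine (Scheme.Hom.comp_appLE (Spec.map (CommRingCat.ofHom (Ideal.Quotient.mk I)))
      hV.fromSpec V ⊤ e).trans ?_
    rw [hV.fromSpec_app_self, Category.assoc, Scheme.Hom.map_appLE,
      Scheme.ΓSpecIso_inv_naturality]
    exact congrArg _ (Scheme.Hom.app_eq_appLE (Spec.map _)).symm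
  rw [h, Category.assoc, Iso.inv_hom_id, Category.comp_id]

theorem IsAffineOpen.ideal_ker_fromSpecQuotient_le (V : Y.affineOpens) (I : Ideal Γ(Y, V)) :
    (V.2.fromSpecQuotient I).ker.ideal V ≤ I := by
  intro x hx
  have hx : (V.2.fromSpecQuotient I).app V x = 0 := Scheme.Hom.ideal_ker_le _ V hx
  have h : _ = Ideal.Quotient.mk I x := congr($(V.2.fromSpecQuotient_appLE I) x)
  have h1 : (V.2.fromSpecQuotient I).app V ≫ (Spec _).presheaf.map
      (homOfLE (V.2.preimage_fromSpecQuotient I).ge).op =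
      (V.2.fromSpecQuotient I).appLE V ⊤ (V.2.preimage_fromSpecQuotient I).ge := by
    rw [Scheme.Hom.app_eq_appLE, Scheme.Hom.appLE_map]
  have h0 : (V.2.fromSpecQuotient I).appLE V ⊤ (V.2.preimage_fromSpecQuotient I).ge x = 0 := by
    rw [← h1]
    rw [CommRingCat.comp_apply, hx, map_zero]
  rw [← Ideal.Quotient.eq_zero_iff_mem, ← h, CommRingCat.comp_apply, h0, map_zero]

theorem Scheme.IdealSheafData.le_ker_fromSpecQuotient (I : Y.IdealSheafData) (V : Y.affineOpens) :
    I ≤ (V.2.fromSpecQuotient (I.ideal V)).ker := by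
  have h : V.2.fromSpecQuotient (I.ideal V) = I.subschemeCover.f V ≫ I.subschemeι :=
    ((I.subschemeCover_map_subschemeι V).trans (I.glueDataObjι_ι V)).symm
  rw [h]
  exact I.ker_subschemeι.ge.trans (Scheme.Hom.le_ker_comp _ _)

theorem Scheme.IdealSheafData.ideal_comap_le (f : X ⟶ Y) [IsAffineHom f] (K : Y.IdealSheafData)
    (V : Y.affineOpens) :
    (K.comap f).ideal ⟨f ⁻¹ᵁ V, V.2.preimage f⟩ ≤ (K.ideal V).map (f.app V).hom := by
  let I := (K.ideal V).map (f.app V).hom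
  have hV : IsAffineOpen (f ⁻¹ᵁ V.1) := V.2.preimage f
  refine le_trans ?_ (IsAffineOpen.ideal_ker_fromSpecQuotient_le ⟨f ⁻¹ᵁ V, hV⟩ I)
  suffices h : K.comap f ≤ (hV.fromSpecQuotient I).ker from h _
  rw [← Scheme.IdealSheafData.le_map_iff_comap_le, Scheme.IdealSheafData.map_ker]
  have h : hV.fromSpecQuotient I ≫ f = Spec.map (CommRingCat.ofHom
      (Ideal.quotientMap I (f.app V).hom Ideal.le_comap_map)) ≫
        V.2.fromSpecQuotient (K.ideal V) := by
    delta IsAffineOpen.fromSpecQuotient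
    rw [Category.assoc, ← IsAffineOpen.SpecMap_appLE_fromSpec f V.2 hV le_rfl,
      ← Spec.map_comp_assoc, ← Spec.map_comp_assoc, ← Scheme.Hom.app_eq_appLE]
    rfl
  rw [h]
  exact (K.le_ker_fromSpecQuotient V).trans (Scheme.Hom.le_ker_comp _ _)

theorem Scheme.IdealSheafData.res_sub_app_mem (f : X ⟶ Y) [IsAffineHom f] (K : Y.IdealSheafData)
    (t : Γ(K.subscheme, ⊤)) (b : Γ(X, ⊤))
    (hb : (K.comap f).subschemeι.appTop b = (subschemeMap _ _ f (K.le_map_comap f)).appTop t)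
    (V : Y.affineOpens) (a : Γ(Y, V))
    (ha : K.subschemeι.app V a = K.subscheme.presheaf.map (homOfLE le_top).op t) :
    X.presheaf.map (homOfLE le_top).op b - f.app V a ∈ (K.ideal V).map (f.app V).hom := by
  have hV : IsAffineOpen (f ⁻¹ᵁ V.1) := V.2.preimage f
  refine K.ideal_comap_le f V ?_
  rw [← ker_subschemeι_app, RingHom.mem_ker, map_sub, sub_eq_zero]
  refine ((K.comap f).subschemeι.app_res_appTop (f ⁻¹ᵁ V.1) b).trans ?_
  rw [hb]
  have := Scheme.Hom.app_eq_res_appTop (subschemeMap _ _ f (K.le_map_comap f)) K.subschemeι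
    ((K.comap f).subschemeι ≫ f) (subschemeMap_subschemeι _ _ _ _) a t ha
  exact this.symm

theorem IsAffineOpen.genericPoint_notMem_support_ker_fromSpecQuotient [IsIntegral Y]
    [QuasiSeparatedSpace Y] {V : Y.Opens} (hV : IsAffineOpen V) {h : Γ(Y, V)} (hh : h ≠ 0) :
    genericPoint Y ∉ (hV.fromSpecQuotient (Ideal.span {h})).ker.support := by
  rw [← SetLike.mem_coe, Scheme.Hom.support_ker]
  have hη : genericPoint Y ∈ Y.basicOpen h := by
    have : Nonempty (Y.basicOpen h) :=
      ((Opens.ne_bot_iff_nonempty _).mp (mt (basicOpen_eq_bot_iff h).mp hh)).to_subtype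
    exact Scheme.genericPoint_mem _
  intro hmem
  obtain ⟨_, hy, z, rfl⟩ := mem_closure_iff.mp hmem _ (Y.basicOpen h).2 hη
  have hz : Spec.map (CommRingCat.ofHom (Ideal.Quotient.mk (Ideal.span {h}))) z ∈
      hV.fromSpec ⁻¹ᵁ Y.basicOpen h := hy
  rw [hV.fromSpec_preimage_basicOpen] at hz
  have h0 : Ideal.Quotient.mk (Ideal.span {h}) h ∈ PrimeSpectrum.asIdeal z := by
    rw [Ideal.Quotient.eq_zero_iff_mem.mpr (Ideal.mem_span_singleton_self h)]
    exact zero_mem _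
  exact hz h0

theorem Scheme.exists_idealSheafData_le_span [IsIntegral Y] [QuasiSeparatedSpace Y]
    (s : Finset Y.affineOpens) (h : ∀ V : Y.affineOpens, Γ(Y, V)) (hh : ∀ V ∈ s, h V ≠ 0) :
    ∃ J : Y.IdealSheafData, genericPoint Y ∉ J.support ∧
      ∀ V ∈ s, J.ideal V ≤ Ideal.span {h V} := by
  classical
  induction s using Finset.induction_on with
  | empty => exact ⟨⊤, id, by simp⟩
  | insert V s hV ih =>
    obtain ⟨J, hJ, hJs⟩ := ih fun W hW ↦ hh W (Finset.mem_insert_of_mem hW)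
    have hVη := V.2.genericPoint_notMem_support_ker_fromSpecQuotient
      (hh V (Finset.mem_insert_self _ _))
    have hle := IsAffineOpen.ideal_ker_fromSpecQuotient_le V (Ideal.span {h V})
    generalize (V.2.fromSpecQuotient (Ideal.span {h V})).ker = J' at hVη hle
    refine ⟨J' * J, ?_, fun W hW ↦ ?_⟩
    · rw [Scheme.IdealSheafData.support_mul]
      rintro (h | h)
      · exact hVη h
      · exact hJ h
    · rw [Scheme.IdealSheafData.ideal_mul]
      obtain rfl | hW := Finset.mem_insert.mp hW
      · exact Ideal.mul_le_left.trans hle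
      · exact Ideal.mul_le_right.trans (hJs W hW)

theorem Scheme.IdealSheafData.mem_basicOpen_iff_of_sub_mem (I : Y.IdealSheafData)
    {V : Y.affineOpens} {c e : Γ(Y, V)} (h : c - e ∈ I.ideal V) {y : Y} (hy : y ∈ I.support)
    (hyV : y ∈ V.1) : y ∈ Y.basicOpen c ↔ y ∈ Y.basicOpen e := by
  have key {c e : Γ(Y, V)} (h : c - e ∈ I.ideal V) (hc : y ∈ Y.basicOpen c) :
      y ∈ Y.basicOpen e := by
    have h0 : y ∉ Y.basicOpen (c - e) :=
      (Y.mem_zeroLocus_iff _ _).mp ((I.mem_support_iff_of_mem hyV).mp hy) _ h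
    have := Y.basicOpen_add_le e (c - e)
    rw [add_sub_cancel] at this
    exact (this hc).resolve_right h0
  exact ⟨key h, key (by rw [← neg_sub]; exact neg_mem h)⟩

theorem Scheme.exists_finset_affineOpens [CompactSpace Y] :
    ∃ s : Finset Y.affineOpens, ∀ y : Y, ∃ V ∈ s, y ∈ V.1 := by
  obtain ⟨s, hs⟩ := isCompact_univ.elim_finite_subcover
    (fun V : Y.affineOpens ↦ (V.1 : Set Y)) (fun V ↦ V.1.isOpen) fun y _ ↦ by
      obtain ⟨U, hU, hyU, -⟩ := exists_isAffineOpen_mem_and_subset (U := ⊤) (x := y) trivial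
      exact Set.mem_iUnion.mpr ⟨⟨U, hU⟩, hyU⟩
  exact ⟨s, fun y ↦ by simpa using hs (Set.mem_univ y)⟩

theorem Scheme.Hom.exists_polynomial [IsIntegral X] [IsAffine X] [IsIntegral Y]
    (f : X ⟶ Y) [IsFinite f] [Surjective f] :
    ∃ J : Y.IdealSheafData, genericPoint Y ∉ J.support ∧
      ∀ (I : Y.IdealSheafData) (t : Γ((J * I).subscheme, ⊤)) (b : Γ(X, ⊤)),
        ((J * I).comap f).subschemeι.appTop b =
          (Scheme.IdealSheafData.subschemeMap _ _ f ((J * I).le_map_comap f)).appTop t →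
        ∃ p : Polynomial Γ(Y, ⊤), p.Monic ∧ p.eval₂ f.appTop.hom b = 0 ∧
          ∀ z : (J * I).subscheme, (J * I).subschemeι z ∈ I.support →
            ((J * I).subschemeι z ∈ Y.basicOpen (p.coeff 0) ↔
              z ∈ (J * I).subscheme.basicOpen t) := by
  classical
  have := f.compactSpace_of_surjective
  have := f.quasiSeparatedSpace_of_surjective
  obtain ⟨φ, n, q, hφ, hn, hq, hV⟩ := f.exists_charpoly
  obtain ⟨s, hs⟩ := Y.exists_finset_affineOpens
  choose h h0 hp using fun V : {V : Y.affineOpens // Nonempty V.1} ↦ @hV V.1 V.2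
  obtain ⟨J, hJ, hJs⟩ := Scheme.exists_idealSheafData_le_span
    (s.filter fun V ↦ Nonempty V.1) (fun V ↦ if hV : Nonempty V.1 then h ⟨V, hV⟩ else 0)
    (fun V hV ↦ by
      have hV' := (Finset.mem_filter.mp hV).2
      rw [dif_pos hV']
      exact h0 ⟨V, hV'⟩)
  refine ⟨J, hJ, fun I t b hb ↦ ?_⟩
  have key (V : Y.affineOpens) (hVs : V ∈ s) [hV' : Nonempty V.1] :
      ∃ (a : Γ(Y, V)) (p : Polynomial Γ(Y, V)),
        (J * I).subschemeι.app V a = (J * I).subscheme.presheaf.map (homOfLE le_top).op t ∧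
        p.map (Y.germToFunctionField V.1).hom = q b ∧ p.coeff 0 - (-a) ^ n ∈ I.ideal V := by
    obtain ⟨a, ha⟩ := IsClosedImmersion.exists_app_eq_res (J * I).subschemeι V.2 le_top t
    have hJV := hJs V (Finset.mem_filter.mpr ⟨hVs, hV'⟩)
    rw [dif_pos hV'] at hJV
    obtain ⟨p, h1, h2⟩ := hp ⟨V, hV'⟩ (I.ideal V) a b
      (Ideal.map_mono (Ideal.mul_mono_left hJV) ((J * I).res_sub_app_mem f t b hb V a ha))
    exact ⟨a, p, ha, h1, h2⟩
  have hlift : q b ∈ Polynomial.lifts (Y.germToFunctionField ⊤).hom := by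
    rw [Polynomial.lifts_iff_coeff_lifts]
    intro i
    refine exists_germToFunctionField_top_eq _ fun y ↦ ?_
    obtain ⟨V, hVs, hyV⟩ := hs y
    have : Nonempty V.1 := ⟨⟨y, hyV⟩⟩
    obtain ⟨a, p, -, h2, -⟩ := key V hVs
    exact ⟨V, this, hyV, p.coeff i, by rw [← h2, Polynomial.coeff_map]⟩
  obtain ⟨p, hpq⟩ := (Polynomial.mem_lifts _).mp hlift
  refine ⟨p, Polynomial.monic_of_injective (Y.germToFunctionField_injective ⊤)
    (hpq ▸ (hq b).1), X.germToFunctionField_injective ⊤ ?_, fun z hz ↦ ?_⟩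
  · have h1 := (hq b).2
    rw [← hpq, Polynomial.eval₂_map] at h1
    rw [map_zero, ← h1]
    have h2 := Polynomial.hom_eval₂ p f.appTop.hom (X.germToFunctionField ⊤).hom b
    refine h2.trans ?_
    congr 1
    ext x
    have : Nonempty (f ⁻¹ᵁ ⊤) := inferInstanceAs (Nonempty (⊤ : X.Opens))
    exact (hφ ⊤ x).symm
  · obtain ⟨V, hVs, hyV⟩ := hs ((J * I).subschemeι z)
    have : Nonempty V.1 := ⟨⟨_, hyV⟩⟩
    obtain ⟨a, r, h1, h2, h3⟩ := key V hVs
    have h4 : Y.presheaf.map (homOfLE le_top).op (p.coeff 0) = r.coeff 0 := by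
      apply Y.germToFunctionField_injective V.1
      refine (germToFunctionField_res _ _).trans ?_
      have := congr(Polynomial.coeff $(hpq.trans h2.symm) 0)
      rwa [Polynomial.coeff_map, Polynomial.coeff_map] at this
    have h5 : (J * I).subschemeι z ∈ Y.basicOpen (p.coeff 0) ↔
        (J * I).subschemeι z ∈ Y.basicOpen (r.coeff 0) := by
      rw [← h4, Scheme.basicOpen_res]
      exact ⟨fun h ↦ ⟨hyV, h⟩, fun h ↦ h.2⟩
    have h6 : z ∈ (J * I).subscheme.basicOpen t ↔ (J * I).subschemeι z ∈ Y.basicOpen a := by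
      have : (J * I).subschemeι ⁻¹ᵁ Y.basicOpen a =
        (J * I).subschemeι ⁻¹ᵁ V ⊓ (J * I).subscheme.basicOpen t := by
        rw [Scheme.preimage_basicOpen, h1, Scheme.basicOpen_res]
      change _ ↔ z ∈ (J * I).subschemeι ⁻¹ᵁ Y.basicOpen a
      rw [this]
      exact ⟨fun h ↦ ⟨hyV, h⟩, fun h ↦ h.2⟩
    rw [h5, h6, I.mem_basicOpen_iff_of_sub_mem h3 hz hyV]
    rw [Y.basicOpen_pow _ hn.bot_lt, neg_eq_neg_one_mul, Y.basicOpen_mul,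
      Y.basicOpen_of_isUnit (isUnit_one.neg), inf_eq_right.mpr (Y.basicOpen_le a)]

theorem Scheme.IdealSheafData.ne_bot_of_genericPoint_notMem [IrreducibleSpace Y]
    {J : Y.IdealSheafData} (hJ : genericPoint Y ∉ J.support) : J ≠ ⊥ := by
  rintro rfl
  exact hJ trivial

theorem Scheme.Hom.isIntegral_appTop_of_forall_ne_bot [IsIntegral X] [IsAffine X]
    [IsIntegral Y] (f : X ⟶ Y) [IsFinite f] [Surjective f]
    (H : ∀ K : Y.IdealSheafData, K ≠ ⊥ → IsAffine K.subscheme) : f.appTop.hom.IsIntegral := by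
  obtain ⟨J, hJ, h⟩ := f.exists_polynomial
  have hK : genericPoint Y ∉ (J * ⊤).support := by
    rintro (h | h)
    exacts [hJ h, h]
  have := H (J * ⊤) (Scheme.IdealSheafData.ne_bot_of_genericPoint_notMem hK)
  refine RingHom.isIntegral_of_forall_isIntegralElem
    (g := (Scheme.IdealSheafData.subschemeMap _ _ f ((J * ⊤).le_map_comap f)).appTop.hom)
    (π := ((J * ⊤).comap f).subschemeι.appTop.hom) ?_ ?_ fun b c hbc ↦ ?_
  · have : IsFinite (Scheme.IdealSheafData.subschemeMap _ _ f ((J * ⊤).le_map_comap f)) := by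
      rw [← Scheme.IdealSheafData.comapIso_hom_snd]
      infer_instance
    exact (Scheme.Hom.finite_appTop _).to_isIntegral
  · exact Scheme.Hom.app_surjective _ ⊤ (isAffineOpen_top X)
  · obtain ⟨p, hp, hpb, -⟩ := h ⊤ c b hbc
    exact ⟨p, hp, hpb⟩

theorem Scheme.Hom.exists_mem_basicOpen_le_of_ne_genericPoint [IsIntegral X] [IsAffine X]
    [IsIntegral Y] (f : X ⟶ Y) [IsFinite f] [Surjective f]
    (H : ∀ K : Y.IdealSheafData, K ≠ ⊥ → IsAffine K.subscheme) {y : Y} (hy : y ≠ genericPoint Y)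
    {U : Y.Opens} (hyU : y ∈ U) : ∃ s : Γ(Y, ⊤), y ∈ Y.basicOpen s ∧ Y.basicOpen s ≤ U := by
  obtain ⟨J, hJ, h⟩ := f.exists_polynomial
  let Z : Closeds Y := Closeds.closure {y} ⊔ U.compl
  let I := Scheme.IdealSheafData.vanishingIdeal Z
  have hI (x : Y) : x ∈ I.support ↔ x ∈ closure {y} ∨ x ∉ U := by
    rw [← SetLike.mem_coe, Scheme.IdealSheafData.coe_support_vanishingIdeal]
    rfl
  have hIη : genericPoint Y ∉ I.support := by
    rw [hI]
    rintro (h | h)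
    · refine hy (Specializes.antisymm (y := genericPoint Y) ?_ (genericPoint_specializes y)).eq
      exact specializes_iff_mem_closure.mpr h
    · have : Nonempty U := ⟨⟨y, hyU⟩⟩
      exact h (Scheme.genericPoint_mem U)
  have hK : genericPoint Y ∉ (J * I).support := by
    rintro (h | h)
    exacts [hJ h, hIη h]
  have := H (J * I) (Scheme.IdealSheafData.ne_bot_of_genericPoint_notMem hK)
  have hsupp {x : Y} (hx : x ∈ I.support) : ∃ z, (J * I).subschemeι z = x :=
    Scheme.IdealSheafData.exists_eq_subschemeι _ (.inr hx)
  have hyI : y ∈ I.support := (hI y).mpr (.inl (subset_closure rfl))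
  obtain ⟨z, hz⟩ := hsupp hyI
  have hzU : z ∈ (J * I).subschemeι ⁻¹ᵁ U := by
    change (J * I).subschemeι z ∈ U
    rwa [hz]
  obtain ⟨t, ht, hzt⟩ := (isAffineOpen_top (J * I).subscheme).exists_basicOpen_le ⟨z, hzU⟩ trivial
  obtain ⟨b, hb⟩ := ((J * I).comap f).subschemeι.app_surjective ⊤ (isAffineOpen_top X)
    ((Scheme.IdealSheafData.subschemeMap _ _ f ((J * I).le_map_comap f)).appTop t)
  obtain ⟨p, -, -, hp⟩ := h I t b hb
  refine ⟨p.coeff 0, ?_, fun x hx ↦ ?_⟩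
  · rw [← hz, hp z (hz.symm ▸ hyI)]
    exact hzt
  · by_contra hxU
    have hxI := (hI x).mpr (.inr hxU)
    obtain ⟨w, rfl⟩ := hsupp hxI
    exact hxU (ht ((hp w hxI).mp hx))

theorem Scheme.Hom.exists_mem_basicOpen_isAffineOpen [IsIntegral X] [IsAffine X]
    [IsIntegral Y] (f : X ⟶ Y) [IsFinite f] [Surjective f]
    (H : ∀ K : Y.IdealSheafData, K ≠ ⊥ → IsAffine K.subscheme) (y : Y) :
    ∃ s : Γ(Y, ⊤), y ∈ Y.basicOpen s ∧ IsAffineOpen (Y.basicOpen s) := by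
  have key {x : Y} (hx : x ≠ genericPoint Y) :
      ∃ s : Γ(Y, ⊤), x ∈ Y.basicOpen s ∧ IsAffineOpen (Y.basicOpen s) := by
    obtain ⟨U, hU, hxU, -⟩ := exists_isAffineOpen_mem_and_subset (U := ⊤) (x := x) trivial
    obtain ⟨s, hxs, hs⟩ := f.exists_mem_basicOpen_le_of_ne_genericPoint H hx hxU
    exact ⟨s, hxs, hU.basicOpen_of_le s hs⟩
  by_cases hy : y = genericPoint Y
  · subst hy
    by_cases h : ∃ x : Y, x ≠ genericPoint Y
    · obtain ⟨x, hx⟩ := h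
      obtain ⟨s, hxs, hs⟩ := key hx
      have : Nonempty (Y.basicOpen s) := ⟨⟨x, hxs⟩⟩
      exact ⟨s, Scheme.genericPoint_mem _, hs⟩
    · push Not at h
      obtain ⟨U, hU, hxU, -⟩ :=
        exists_isAffineOpen_mem_and_subset (U := ⊤) (x := genericPoint Y) trivial
      have hUt : Y.basicOpen (1 : Γ(Y, ⊤)) = U := by
        rw [Scheme.basicOpen_one, eq_comm, eq_top_iff]
        intro x _
        rwa [h x]
      exact ⟨1, hUt ▸ hxU, hUt ▸ hU⟩
  · exact key hy

theorem Scheme.Hom.appTop_injective_of_surjective [IsIntegral X] [IsIntegral Y]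
    (f : X ⟶ Y) [IsFinite f] [Surjective f] : Function.Injective f.appTop := by
  obtain ⟨φ, -, -, hφ, -⟩ := f.exists_charpoly
  have : Nonempty (f ⁻¹ᵁ ⊤) := inferInstanceAs (Nonempty (⊤ : X.Opens))
  have h : Function.Injective (φ ∘ Y.germToFunctionField ⊤) :=
    φ.injective.comp (Y.germToFunctionField_injective ⊤)
  intro s t hst
  apply h
  have hs := hφ ⊤ s
  have ht := hφ ⊤ t
  exact hs.trans ((congrArg (X.germToFunctionField ⊤) hst).trans ht.symm)

theorem isAffine_of_isIntegral_appTop [IsAffine X] (f : X ⟶ Y) (hf : f.appTop.hom.IsIntegral)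
    (hf' : Function.Injective f.appTop)
    (h : ∀ y : Y, ∃ s : Γ(Y, ⊤), y ∈ Y.basicOpen s ∧ IsAffineOpen (Y.basicOpen s)) :
    IsAffine Y := by
  let S : Set Γ(Y, ⊤) := {s | IsAffineOpen (Y.basicOpen s)}
  refine isAffine_of_isAffineOpen_basicOpen S ?_ fun _ hs ↦ hs
  by_contra hS
  obtain ⟨m, hm, hSm⟩ := Ideal.exists_le_maximal _ hS
  obtain ⟨P, hP⟩ := hf.comap_surjective hf' ⟨m, hm.isPrime⟩
  obtain ⟨s, hs, hsa⟩ := h (f ((isAffineOpen_top X).fromSpec P))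
  have hP' : P ∈ (isAffineOpen_top X).fromSpec ⁻¹ᵁ (f ⁻¹ᵁ Y.basicOpen s) := hs
  rw [Scheme.preimage_basicOpen_top, (isAffineOpen_top X).fromSpec_preimage_basicOpen] at hP'
  have hsm : s ∈ (PrimeSpectrum.comap f.appTop.hom P).asIdeal := by
    rw [hP]
    exact hSm (Ideal.subset_span hsa)
  exact hP' hsm

theorem isAffine_of_isFinite_of_isIntegral [IsIntegral X] [IsAffine X] [IsIntegral Y] (f : X ⟶ Y)
    [IsFinite f] [Surjective f] (H : ∀ K : Y.IdealSheafData, K ≠ ⊥ → IsAffine K.subscheme) :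
    IsAffine Y :=
  isAffine_of_isIntegral_appTop f (f.isIntegral_appTop_of_forall_ne_bot H)
    f.appTop_injective_of_surjective (f.exists_mem_basicOpen_isAffineOpen H)

/-- A finite surjective morphism from an affine scheme to an integral scheme can be replaced by
one whose source is moreover integral. -/
theorem exists_isFinite_surjective_of_isIntegral [IsAffine X] [IsIntegral Y] (f : X ⟶ Y)
    [IsFinite f] [Surjective f] :
    ∃ (Z : Scheme.{u}) (g : Z ⟶ Y), IsIntegral Z ∧ IsAffine Z ∧ IsFinite g ∧ Surjective g := by
  obtain ⟨x, hx⟩ := f.surjective (genericPoint Y)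
  obtain ⟨P, rfl⟩ : ∃ P, (isAffineOpen_top X).fromSpec P = x := by
    rw [← Set.mem_range, (isAffineOpen_top X).range_fromSpec]
    trivial
  have : IsIso (isAffineOpen_top X).fromSpec := by
    have : Surjective (isAffineOpen_top X).fromSpec :=
      ⟨by rw [← Set.range_eq_univ, (isAffineOpen_top X).range_fromSpec]; rfl⟩
    exact IsOpenImmersion.isIso _
  have : IsClosedImmersion
      (Spec.map (CommRingCat.ofHom (Ideal.Quotient.mk (PrimeSpectrum.asIdeal P)))) :=
    IsClosedImmersion.spec_of_surjective _ Ideal.Quotient.mk_surjective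
  let g := Spec.map (CommRingCat.ofHom (Ideal.Quotient.mk (PrimeSpectrum.asIdeal P))) ≫
    (isAffineOpen_top X).fromSpec ≫ f
  have hg : IsFinite g := inferInstance
  have : IsDomain (CommRingCat.of (Γ(X, ⊤) ⧸ PrimeSpectrum.asIdeal P)) :=
    have : (PrimeSpectrum.asIdeal P).IsPrime := PrimeSpectrum.isPrime P
    Ideal.Quotient.isDomain _
  refine ⟨_, g, inferInstance, inferInstance, hg, ⟨?_⟩⟩
  rw [← Set.range_eq_univ, ← Set.univ_subset_iff]
  refine ((genericPoint_spec Y).mem_closed_set_iff g.isClosedMap.isClosed_range).mp ?_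
  obtain ⟨z, hz⟩ : P ∈ Set.range
      (PrimeSpectrum.comap (Ideal.Quotient.mk (PrimeSpectrum.asIdeal P))) := by
    rw [range_comap_of_surjective _ _ Ideal.Quotient.mk_surjective, Ideal.mk_ker]
    exact Set.Subset.rfl
  refine ⟨z, Eq.trans ?_ hx⟩
  exact congrArg (fun P ↦ f ((isAffineOpen_top X).fromSpec P)) hz

end AlgebraicGeometry

/-- Affineness descends along finite surjective morphisms of schemes:
if `f : X ⟶ Y` is finite and surjective and `X` is affine, then `Y` is affine. -/
theorem isAffine_of_isFinite_surjective {X Y : Scheme} (f : X ⟶ Y)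
    [IsFinite f] [AlgebraicGeometry.Surjective f] [IsAffine X] : IsAffine Y := by
  refine isAffine_of_minimal (fun {X Y} f _ _ _ H ↦ ?_) f
  obtain _ | h := isIntegral_or_isAffine_of_minimal H
  · obtain ⟨Z, g, _, _, _, _⟩ := exists_isFinite_surjective_of_isIntegral f
    exact isAffine_of_isFinite_of_isIntegral g H
  · exact h
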